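/- Let p, q, r, μ be real polynomials with deg p ≤ m, deg q ≤ n, deg r ≤ l and deg μ = s, such that μ(k) ∈ (0,1) and μ(k) ≠ k² for all k ∈ (−1,1). Suppose the function I(k) = p(k)K(k) + q(k)E(k) + r(k)Π(μ(k),k) is not identically zero on (−1,1). Then the number of zeros of I in (−1,1), counted with multiplicity, does not exceed ψ(m,n,l,s), where: if s ≥ 2, ψ = 2·max{m,n} + 3l + 6s + 7 when l ≤ max{m,n} + s, and ψ = 5l + 4s + 7 when l > max{m,n} + s; if s = 1, ψ = 2·max{m,n} + 3l + 15 when l ≤ max{m,n} + 1, and ψ = 5l + 13 when l > max{m,n} + 1; if s = 0, ψ = 2·max{m,n} + 3l + 11 when l ≤ max{m,n} + 2, and ψ = max{m,n} + 4l + 9 when l > max{m,n} + 2. -/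

import Mathlib

/-- Complete elliptic integral of the first kind. -/
noncomputable def Kc (k : ℝ) : ℝ :=
  ∫ z in (0:ℝ)..1, 1 / Real.sqrt ((1 - z ^ 2) * (1 - k ^ 2 * z ^ 2))

/-- Complete elliptic integral of the second kind. -/
noncomputable def Ec (k : ℝ) : ℝ :=
  ∫ z in (0:ℝ)..1, Real.sqrt (1 - k ^ 2 * z ^ 2) / Real.sqrt (1 - z ^ 2)

/-- Complete elliptic integral of the third kind. -/
noncomputable def Pic (μ k : ℝ) : ℝ :=
  ∫ z in (0:ℝ)..1, 1 / ((1 - μ * z ^ 2) * Real.sqrt ((1 - z ^ 2) * (1 - k ^ 2 * z ^ 2)))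

/-- Multiplicity (order of vanishing) of a zero of a real function. -/
noncomputable def zeroMult (φ : ℝ → ℝ) (x : ℝ) : ℕ :=
  sInf {n : ℕ | iteratedDeriv n φ x ≠ 0}

/-- The zero-count bound `ψ(m,n,l,s)` of Theorem 1.3. -/
def psiBound (m n l s : ℕ) : ℕ :=
  if 2 ≤ s then
    (if l ≤ max m n + s then 2 * max m n + 3 * l + 6 * s + 7 else 5 * l + 4 * s + 7)
  else if s = 1 then
    (if l ≤ max m n + 1 then 2 * max m n + 3 * l + 15 else 5 * l + 13)
  else
    (if l ≤ max m n + 2 then 2 * max m n + 3 * l + 11 else max m n + 4 * l + 9)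

section

open Set Filter Topology MeasureTheory Complex Polynomial

/-! ### Trigonometric forms of the elliptic integrals -/

theorem integral_zero_one_eq_integral_cos_mul_comp_sin (g : ℝ → ℝ) :
    ∫ z in (0 : ℝ)..1, g z = ∫ θ in (0 : ℝ)..(Real.pi / 2), Real.cos θ * g (Real.sin θ) := by
  have hpi := Real.pi_pos
  have himg : Real.sin '' Ioo 0 (Real.pi / 2) = Ioo 0 1 := by
    ext y
    constructor
    · rintro ⟨x, hx, rfl⟩
      refine ⟨Real.sin_pos_of_pos_of_lt_pi hx.1 (by linarith [hx.2]), ?_⟩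
      rw [← Real.sin_pi_div_two]
      exact Real.strictMonoOn_sin ⟨by linarith [hx.1], hx.2.le⟩ ⟨by linarith, le_rfl⟩ hx.2
    · intro hy
      refine ⟨Real.arcsin y, ⟨Real.arcsin_pos.2 hy.1, Real.arcsin_lt_pi_div_two.2 hy.2⟩, ?_⟩
      exact Real.sin_arcsin (by linarith [hy.1]) hy.2.le
  have hinj : InjOn Real.sin (Ioo 0 (Real.pi / 2)) :=
    Real.injOn_sin.mono (Ioo_subset_Icc_self.trans (Icc_subset_Icc_left (by linarith)))
  rw [intervalIntegral.integral_of_le zero_le_one, intervalIntegral.integral_of_le (by positivity),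
    integral_Ioc_eq_integral_Ioo, integral_Ioc_eq_integral_Ioo, ← himg,
    integral_image_eq_integral_abs_deriv_smul measurableSet_Ioo
      (fun x _ => (Real.hasDerivAt_sin x).hasDerivWithinAt) hinj]
  refine setIntegral_congr_fun measurableSet_Ioo fun x hx => ?_
  have : 0 < Real.cos x := Real.cos_pos_of_mem_Ioo ⟨by linarith [hx.1], hx.2⟩
  simp [abs_of_pos this]

theorem integral_congr_of_cos_pos {f g : ℝ → ℝ} (h : ∀ θ, 0 < Real.cos θ → f θ = g θ) :
    ∫ θ in (0 : ℝ)..(Real.pi / 2), f θ = ∫ θ in (0 : ℝ)..(Real.pi / 2), g θ := by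
  have hpi := Real.pi_pos
  rw [intervalIntegral.integral_of_le (by positivity), intervalIntegral.integral_of_le (by positivity),
    integral_Ioc_eq_integral_Ioo, integral_Ioc_eq_integral_Ioo]
  exact setIntegral_congr_fun measurableSet_Ioo fun x hx =>
    h x (Real.cos_pos_of_mem_Ioo ⟨by linarith [hx.1], hx.2⟩)

theorem sqrt_one_sub_sin_sq_mul {θ : ℝ} (h : 0 < Real.cos θ) (b : ℝ) :
    Real.sqrt ((1 - Real.sin θ ^ 2) * b) = Real.cos θ * Real.sqrt b := by
  rw [← Real.cos_sq', Real.sqrt_mul (sq_nonneg _), Real.sqrt_sq h.le]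

theorem Kc_eq_integral (k : ℝ) : Kc k =
    ∫ θ in (0 : ℝ)..(Real.pi / 2), 1 / Real.sqrt (1 - k ^ 2 * Real.sin θ ^ 2) := by
  rw [Kc, integral_zero_one_eq_integral_cos_mul_comp_sin]
  refine integral_congr_of_cos_pos fun θ h => ?_
  rw [sqrt_one_sub_sin_sq_mul h]
  field_simp

theorem Ec_eq_integral (k : ℝ) : Ec k =
    ∫ θ in (0 : ℝ)..(Real.pi / 2), Real.sqrt (1 - k ^ 2 * Real.sin θ ^ 2) := by
  rw [Ec, integral_zero_one_eq_integral_cos_mul_comp_sin]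
  refine integral_congr_of_cos_pos fun θ h => ?_
  have := sqrt_one_sub_sin_sq_mul h 1
  rw [mul_one, Real.sqrt_one, mul_one] at this
  rw [this]
  field_simp

theorem Pic_eq_integral (a k : ℝ) : Pic a k =
    ∫ θ in (0 : ℝ)..(Real.pi / 2),
      1 / ((1 - a * Real.sin θ ^ 2) * Real.sqrt (1 - k ^ 2 * Real.sin θ ^ 2)) := by
  rw [Pic, integral_zero_one_eq_integral_cos_mul_comp_sin]
  refine integral_congr_of_cos_pos fun θ h => ?_
  rw [sqrt_one_sub_sin_sq_mul h, mul_left_comm]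
  field_simp

/-! ### Parametric integrals -/

theorem hasDerivAt_intervalIntegral_of_continuousOn {𝕜 : Type*} [RCLike 𝕜] {F F' : 𝕜 → ℝ → 𝕜}
    {U : Set 𝕜} (hU : IsOpen U) {a b : ℝ} (hab : a ≤ b)
    (hF : ContinuousOn (fun p : 𝕜 × ℝ => F p.1 p.2) (U ×ˢ Icc a b))
    (hF' : ContinuousOn (fun p : 𝕜 × ℝ => F' p.1 p.2) (U ×ˢ Icc a b))
    (hd : ∀ x ∈ U, ∀ t ∈ Icc a b, HasDerivAt (fun x => F x t) (F' x t) x) {x₀ : 𝕜} (hx₀ : x₀ ∈ U) :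
    HasDerivAt (fun x => ∫ t in a..b, F x t) (∫ t in a..b, F' x₀ t) x₀ := by
  obtain ⟨ε, hε, hball⟩ := Metric.nhds_basis_closedBall.mem_iff.1 (hU.mem_nhds hx₀)
  have hsub : Metric.closedBall x₀ ε ×ˢ Icc a b ⊆ U ×ˢ Icc a b := prod_mono hball subset_rfl
  obtain ⟨C, hC⟩ := ((isCompact_closedBall x₀ ε).prod isCompact_Icc).exists_bound_of_continuousOn
    (hF'.mono hsub)
  have slice : ∀ {G : 𝕜 → ℝ → 𝕜}, ContinuousOn (fun p : 𝕜 × ℝ => G p.1 p.2) (U ×ˢ Icc a b) →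
      ∀ x ∈ U, ContinuousOn (G x) (Icc a b) := fun hG x hx =>
    hG.comp (f := fun t => (x, t)) (by fun_prop) fun t ht => ⟨hx, ht⟩
  have hioc : uIoc a b ⊆ Icc a b := by rw [uIoc_of_le hab]; exact Ioc_subset_Icc_self
  refine (intervalIntegral.hasDerivAt_integral_of_dominated_loc_of_deriv_le (bound := fun _ => C)
    (Metric.closedBall_mem_nhds x₀ hε) ?_ ?_ ?_ ?_ ?_ ?_).2
  · filter_upwards [hU.mem_nhds hx₀] with x hx
    exact ((slice hF x hx).mono hioc).aestronglyMeasurable measurableSet_uIoc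
  · exact ContinuousOn.intervalIntegrable (by rw [uIcc_of_le hab]; exact slice hF x₀ hx₀)
  · exact ((slice hF' x₀ hx₀).mono hioc).aestronglyMeasurable measurableSet_uIoc
  · exact ae_of_all _ fun t ht x hx => hC (x, t) ⟨hx, hioc ht⟩
  · exact intervalIntegrable_const
  · exact ae_of_all _ fun t ht x hx => hd x (hball hx) t (hioc ht)

/-! ### Differential equations of the complete elliptic integrals -/

theorem one_sub_sq_pos {k : ℝ} (hk : k ∈ Ioo (-1 : ℝ) 1) : 0 < 1 - k ^ 2 := by
  nlinarith [hk.1, hk.2]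

theorem one_sub_mul_sin_sq_pos {a : ℝ} (ha : a < 1) (θ : ℝ) : 0 < 1 - a * Real.sin θ ^ 2 := by
  rcases eq_or_ne (Real.sin θ) 0 with h | h
  · simp [h]
  · have := mul_pos (sub_pos.2 ha) (pow_pos (abs_pos.2 h) 2)
    rw [sq_abs] at this
    linarith [Real.sin_sq_le_one θ]

theorem one_sub_sq_mul_sin_sq_pos {k : ℝ} (hk : k ∈ Ioo (-1 : ℝ) 1) (θ : ℝ) :
    0 < 1 - k ^ 2 * Real.sin θ ^ 2 :=
  one_sub_mul_sin_sq_pos (by linarith [one_sub_sq_pos hk]) θ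

theorem hasDerivAt_sqrt_one_sub_sq_mul {k : ℝ} (hk : k ∈ Ioo (-1 : ℝ) 1) (θ : ℝ) :
    HasDerivAt (fun k : ℝ => Real.sqrt (1 - k ^ 2 * Real.sin θ ^ 2))
      (-(k * Real.sin θ ^ 2) / Real.sqrt (1 - k ^ 2 * Real.sin θ ^ 2)) k := by
  have hpos := one_sub_sq_mul_sin_sq_pos hk θ
  have h := ((((hasDerivAt_id k).pow 2).mul_const (Real.sin θ ^ 2)).const_sub 1).sqrt hpos.ne'
  refine h.congr_deriv ?_
  have := (Real.sqrt_pos.2 hpos).ne'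
  simp only [id_eq, Pi.pow_apply]
  field_simp
  ring

theorem hasDerivAt_sqrt_one_sub_mul_sin_sq {k : ℝ} (hk : k ∈ Ioo (-1 : ℝ) 1) (θ : ℝ) :
    HasDerivAt (fun θ : ℝ => Real.sqrt (1 - k ^ 2 * Real.sin θ ^ 2))
      (-(k ^ 2 * Real.sin θ * Real.cos θ) / Real.sqrt (1 - k ^ 2 * Real.sin θ ^ 2)) θ := by
  have hpos := one_sub_sq_mul_sin_sq_pos hk θ
  have h := ((((Real.hasDerivAt_sin θ).pow 2).const_mul (k ^ 2)).const_sub 1).sqrt hpos.ne'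
  refine h.congr_deriv ?_
  have := (Real.sqrt_pos.2 hpos).ne'
  simp only [Pi.pow_apply]
  field_simp
  ring

theorem continuous_sqrt_one_sub (k : ℝ) :
    Continuous (fun θ : ℝ => Real.sqrt (1 - k ^ 2 * Real.sin θ ^ 2)) := by
  fun_prop

theorem hasDerivAt_sin_mul_cos_div_sqrt {k : ℝ} (hk : k ∈ Ioo (-1 : ℝ) 1) (θ : ℝ) : HasDerivAt
    (fun θ => Real.sin θ * Real.cos θ / Real.sqrt (1 - k ^ 2 * Real.sin θ ^ 2))
    ((1 - 2 * Real.sin θ ^ 2) / Real.sqrt (1 - k ^ 2 * Real.sin θ ^ 2) +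
      k ^ 2 * Real.sin θ ^ 2 * (1 - Real.sin θ ^ 2) /
        Real.sqrt (1 - k ^ 2 * Real.sin θ ^ 2) ^ 3) θ := by
  have := (Real.sqrt_pos.2 (one_sub_sq_mul_sin_sq_pos hk θ)).ne'
  refine (((Real.hasDerivAt_sin θ).mul (Real.hasDerivAt_cos θ)).div
    (hasDerivAt_sqrt_one_sub_mul_sin_sq hk θ) this).congr_deriv ?_
  have h2 : Real.cos θ ^ 2 = 1 - Real.sin θ ^ 2 := Real.cos_sq' θ
  simp only [Pi.mul_apply]
  generalize √(1 - k ^ 2 * Real.sin θ ^ 2) = D at this ⊢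
  field_simp
  linear_combination (D ^ 2 + k ^ 2 * Real.sin θ ^ 2) * h2

theorem hasDerivAt_sin_mul_cos_mul_sqrt_div {k a : ℝ} (hk : k ∈ Ioo (-1 : ℝ) 1) (ha : a < 1)
    (θ : ℝ) : HasDerivAt
    (fun θ => Real.sin θ * Real.cos θ * Real.sqrt (1 - k ^ 2 * Real.sin θ ^ 2) /
      (1 - a * Real.sin θ ^ 2))
    ((1 - 2 * Real.sin θ ^ 2) * Real.sqrt (1 - k ^ 2 * Real.sin θ ^ 2) / (1 - a * Real.sin θ ^ 2) -
      k ^ 2 * Real.sin θ ^ 2 * (1 - Real.sin θ ^ 2) /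
        (Real.sqrt (1 - k ^ 2 * Real.sin θ ^ 2) * (1 - a * Real.sin θ ^ 2)) +
      2 * a * Real.sin θ ^ 2 * (1 - Real.sin θ ^ 2) * Real.sqrt (1 - k ^ 2 * Real.sin θ ^ 2) /
        (1 - a * Real.sin θ ^ 2) ^ 2) θ := by
  have := (Real.sqrt_pos.2 (one_sub_sq_mul_sin_sq_pos hk θ)).ne'
  have h1 := (one_sub_mul_sin_sq_pos ha θ).ne'
  refine ((((Real.hasDerivAt_sin θ).mul (Real.hasDerivAt_cos θ)).mul
    (hasDerivAt_sqrt_one_sub_mul_sin_sq hk θ)).div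
    ((((Real.hasDerivAt_sin θ).pow 2).const_mul a).const_sub 1) h1).congr_deriv ?_
  have h2 : Real.cos θ ^ 2 = 1 - Real.sin θ ^ 2 := Real.cos_sq' θ
  simp only [Pi.mul_apply, Pi.pow_apply]
  generalize √(1 - k ^ 2 * Real.sin θ ^ 2) = D at this ⊢
  rw [← h2]
  field_simp
  simp only [Nat.cast_ofNat, Nat.add_one_sub_one, pow_one]
  rw [show Real.cos θ ^ 2 = 1 - Real.sin θ ^ 2 from h2]
  ring

theorem exists_hasDerivAt_Ec {k : ℝ} (hk : k ∈ Ioo (-1 : ℝ) 1) :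
    ∃ e, HasDerivAt Ec e k ∧ k * e = Ec k - Kc k := by
  have hne : ∀ k ∈ Ioo (-1 : ℝ) 1, ∀ θ : ℝ, Real.sqrt (1 - k ^ 2 * Real.sin θ ^ 2) ≠ 0 :=
    fun k hk θ => (Real.sqrt_pos.2 (one_sub_sq_mul_sin_sq_pos hk θ)).ne'
  have h := hasDerivAt_intervalIntegral_of_continuousOn (𝕜 := ℝ)
    (F := fun k θ => Real.sqrt (1 - k ^ 2 * Real.sin θ ^ 2))
    (F' := fun k θ => -(k * Real.sin θ ^ 2) / Real.sqrt (1 - k ^ 2 * Real.sin θ ^ 2))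
    isOpen_Ioo (a := 0) (b := Real.pi / 2) (by positivity)
    (by fun_prop)
    (ContinuousOn.div (by fun_prop) (by fun_prop) fun p hp => hne _ hp.1 _)
    (fun x hx t _ => hasDerivAt_sqrt_one_sub_sq_mul hx t) hk
  refine ⟨_, by simpa only [funext Ec_eq_integral] using h, ?_⟩
  have hc := continuous_sqrt_one_sub k
  have i1 : IntervalIntegrable (fun θ => Real.sqrt (1 - k ^ 2 * Real.sin θ ^ 2)) volume
      0 (Real.pi / 2) := hc.intervalIntegrable _ _
  have i2 : IntervalIntegrable (fun θ => 1 / Real.sqrt (1 - k ^ 2 * Real.sin θ ^ 2)) volume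
      0 (Real.pi / 2) := (continuous_const.div hc (hne k hk)).intervalIntegrable _ _
  rw [Ec_eq_integral, Kc_eq_integral, ← intervalIntegral.integral_const_mul,
    ← intervalIntegral.integral_sub i1 i2]
  refine intervalIntegral.integral_congr fun θ _ => ?_
  have h1 := hne k hk θ
  have h2 := Real.sq_sqrt (one_sub_sq_mul_sin_sq_pos hk θ).le
  generalize √(1 - k ^ 2 * Real.sin θ ^ 2) = D at h1 h2 ⊢
  field_simp
  linear_combination -h2

theorem exists_hasDerivAt_Kc {k : ℝ} (hk : k ∈ Ioo (-1 : ℝ) 1) :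
    ∃ e, HasDerivAt Kc e k ∧ k * (1 - k ^ 2) * e = Ec k - (1 - k ^ 2) * Kc k := by
  have hne : ∀ k ∈ Ioo (-1 : ℝ) 1, ∀ θ : ℝ, Real.sqrt (1 - k ^ 2 * Real.sin θ ^ 2) ≠ 0 :=
    fun k hk θ => (Real.sqrt_pos.2 (one_sub_sq_mul_sin_sq_pos hk θ)).ne'
  have h := hasDerivAt_intervalIntegral_of_continuousOn (𝕜 := ℝ)
    (F := fun k θ => 1 / Real.sqrt (1 - k ^ 2 * Real.sin θ ^ 2))
    (F' := fun k θ => k * Real.sin θ ^ 2 / Real.sqrt (1 - k ^ 2 * Real.sin θ ^ 2) ^ 3)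
    isOpen_Ioo (a := 0) (b := Real.pi / 2) (by positivity)
    (ContinuousOn.div (by fun_prop) (by fun_prop) fun p hp => hne _ hp.1 _)
    (ContinuousOn.div (by fun_prop) (by fun_prop) fun p hp => pow_ne_zero _ (hne _ hp.1 _))
    (fun x hx t _ => by
      have := hne x hx t
      refine ((hasDerivAt_const x (1 : ℝ)).div (hasDerivAt_sqrt_one_sub_sq_mul hx t)
        (hne x hx t)).congr_deriv ?_
      field_simp
      ring) hk
  refine ⟨_, by simpa only [funext Kc_eq_integral] using h, ?_⟩
  have hc := continuous_sqrt_one_sub k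
  have hprimitive := intervalIntegral.integral_eq_sub_of_hasDerivAt
    (a := 0) (b := Real.pi / 2) (fun θ _ => hasDerivAt_sin_mul_cos_div_sqrt hk θ)
    (Continuous.intervalIntegrable (Continuous.add
      (Continuous.div (by fun_prop) (by fun_prop) (hne k hk))
      (Continuous.div (by fun_prop) (by fun_prop) fun θ => pow_ne_zero _ (hne k hk θ))) _ _)
  simp only [Real.sin_zero, Real.cos_pi_div_two, mul_zero, zero_mul, zero_div, sub_zero] at hprimitive
  have i1 : IntervalIntegrable (fun θ => Real.sqrt (1 - k ^ 2 * Real.sin θ ^ 2)) volume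
      0 (Real.pi / 2) := hc.intervalIntegrable _ _
  have i2 : IntervalIntegrable (fun θ => 1 / Real.sqrt (1 - k ^ 2 * Real.sin θ ^ 2)) volume
      0 (Real.pi / 2) := (continuous_const.div hc (hne k hk)).intervalIntegrable _ _
  have i3 : IntervalIntegrable (fun θ => k * Real.sin θ ^ 2 /
      Real.sqrt (1 - k ^ 2 * Real.sin θ ^ 2) ^ 3) volume 0 (Real.pi / 2) :=
    (Continuous.div (by fun_prop) (by fun_prop) fun θ =>
      pow_ne_zero _ (hne k hk θ)).intervalIntegrable _ _
  have key : ∫ θ in (0 : ℝ)..(Real.pi / 2), (Real.sqrt (1 - k ^ 2 * Real.sin θ ^ 2) -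
      (1 - k ^ 2) * (1 / Real.sqrt (1 - k ^ 2 * Real.sin θ ^ 2)) -
      k * (1 - k ^ 2) * (k * Real.sin θ ^ 2 / Real.sqrt (1 - k ^ 2 * Real.sin θ ^ 2) ^ 3)) = 0 := by
    have hz := congrArg (fun x => k ^ 2 * x) hprimitive
    beta_reduce at hz
    rw [← intervalIntegral.integral_const_mul, mul_zero] at hz
    refine Eq.trans ?_ hz
    refine intervalIntegral.integral_congr fun θ _ => ?_
    have h1 := hne k hk θ
    have h2 := Real.sq_sqrt (one_sub_sq_mul_sin_sq_pos hk θ).le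
    generalize √(1 - k ^ 2 * Real.sin θ ^ 2) = D at h1 h2 ⊢
    field_simp
    rw [h2]
    ring
  rw [intervalIntegral.integral_sub (i1.sub (i2.const_mul _)) (i3.const_mul _),
    intervalIntegral.integral_sub i1 (i2.const_mul _), intervalIntegral.integral_const_mul,
    intervalIntegral.integral_const_mul] at key
  rw [Ec_eq_integral, Kc_eq_integral]
  linarith

theorem exists_hasDerivAt_Pic {μ : ℝ[X]} {k : ℝ} (hk : k ∈ Ioo (-1 : ℝ) 1)
    (hμ : ∀ k ∈ Ioo (-1 : ℝ) 1, μ.eval k < 1) :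
    ∃ e, HasDerivAt (fun k => Pic (μ.eval k) k) e k ∧
      2 * μ.eval k * (1 - μ.eval k) * (μ.eval k - k ^ 2) * (1 - k ^ 2) * e =
        (2 * k * μ.eval k * (1 - μ.eval k) * (1 - k ^ 2) +
          μ.derivative.eval k * (μ.eval k ^ 2 - k ^ 2) * (1 - k ^ 2)) * Pic (μ.eval k) k +
        (μ.derivative.eval k * μ.eval k * (1 - k ^ 2) - 2 * k * μ.eval k * (1 - μ.eval k)) * Ec k -
        μ.derivative.eval k * (μ.eval k - k ^ 2) * (1 - k ^ 2) * Kc k := by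
  have hne : ∀ k ∈ Ioo (-1 : ℝ) 1, ∀ θ : ℝ, Real.sqrt (1 - k ^ 2 * Real.sin θ ^ 2) ≠ 0 :=
    fun k hk θ => (Real.sqrt_pos.2 (one_sub_sq_mul_sin_sq_pos hk θ)).ne'
  have hne' : ∀ k ∈ Ioo (-1 : ℝ) 1, ∀ θ : ℝ, 1 - μ.eval k * Real.sin θ ^ 2 ≠ 0 :=
    fun k hk θ => (one_sub_mul_sin_sq_pos (hμ k hk) θ).ne'
  have hμc := μ.continuous
  have hμc' := μ.derivative.continuous
  have h := hasDerivAt_intervalIntegral_of_continuousOn (𝕜 := ℝ)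
    (F := fun k θ => 1 / ((1 - μ.eval k * Real.sin θ ^ 2) *
      Real.sqrt (1 - k ^ 2 * Real.sin θ ^ 2)))
    (F' := fun k θ => μ.derivative.eval k * Real.sin θ ^ 2 / ((1 - μ.eval k * Real.sin θ ^ 2) ^ 2 *
      Real.sqrt (1 - k ^ 2 * Real.sin θ ^ 2)) + k * Real.sin θ ^ 2 /
      ((1 - μ.eval k * Real.sin θ ^ 2) * Real.sqrt (1 - k ^ 2 * Real.sin θ ^ 2) ^ 3))
    isOpen_Ioo (a := 0) (b := Real.pi / 2) (by positivity)
    (ContinuousOn.div (by fun_prop) (by fun_prop) fun p hp =>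
      mul_ne_zero (hne' _ hp.1 _) (hne _ hp.1 _))
    (ContinuousOn.add
      (ContinuousOn.div (by fun_prop) (by fun_prop) fun p hp =>
        mul_ne_zero (pow_ne_zero _ (hne' _ hp.1 _)) (hne _ hp.1 _))
      (ContinuousOn.div (by fun_prop) (by fun_prop) fun p hp =>
        mul_ne_zero (hne' _ hp.1 _) (pow_ne_zero _ (hne _ hp.1 _))))
    (fun x hx t _ => by
      have h1 := hne x hx t
      have h2 := hne' x hx t
      refine ((hasDerivAt_const x (1 : ℝ)).div ((((μ.hasDerivAt x).mul_const
        (Real.sin t ^ 2)).const_sub 1).mul (hasDerivAt_sqrt_one_sub_sq_mul hx t))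
        (mul_ne_zero h2 h1)).congr_deriv ?_
      simp only [Pi.mul_apply]
      generalize √(1 - x ^ 2 * Real.sin t ^ 2) = D at h1 ⊢
      field_simp
      ring) hk
  refine ⟨_, by simpa only [Pic_eq_integral] using h, ?_⟩
  have ha := hμ k hk
  have h1 := hne k hk
  have h2 := hne' k hk
  generalize μ.derivative.eval k = a' at *
  generalize μ.eval k = a at *
  have i1 : IntervalIntegrable (fun θ => Real.sqrt (1 - k ^ 2 * Real.sin θ ^ 2)) volume
      0 (Real.pi / 2) := (continuous_sqrt_one_sub k).intervalIntegrable _ _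
  have i2 : IntervalIntegrable (fun θ => 1 / Real.sqrt (1 - k ^ 2 * Real.sin θ ^ 2)) volume
      0 (Real.pi / 2) :=
    (continuous_const.div (continuous_sqrt_one_sub k) (hne k hk)).intervalIntegrable _ _
  have i3 : IntervalIntegrable (fun θ => 1 / ((1 - a * Real.sin θ ^ 2) *
      Real.sqrt (1 - k ^ 2 * Real.sin θ ^ 2))) volume 0 (Real.pi / 2) :=
    (Continuous.div (by fun_prop) (by fun_prop) fun θ =>
      mul_ne_zero (h2 θ) (h1 θ)).intervalIntegrable _ _
  have i4 : IntervalIntegrable (fun θ => a' * Real.sin θ ^ 2 / ((1 - a * Real.sin θ ^ 2) ^ 2 *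
      Real.sqrt (1 - k ^ 2 * Real.sin θ ^ 2)) + k * Real.sin θ ^ 2 /
      ((1 - a * Real.sin θ ^ 2) * Real.sqrt (1 - k ^ 2 * Real.sin θ ^ 2) ^ 3)) volume
      0 (Real.pi / 2) :=
    (Continuous.add
      (Continuous.div (by fun_prop) (by fun_prop) fun θ =>
        mul_ne_zero (pow_ne_zero _ (h2 θ)) (h1 θ))
      (Continuous.div (by fun_prop) (by fun_prop) fun θ =>
        mul_ne_zero (h2 θ) (pow_ne_zero _ (h1 θ)))).intervalIntegrable _ _
  have i5 : IntervalIntegrable (fun θ => (1 - 2 * Real.sin θ ^ 2) /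
      Real.sqrt (1 - k ^ 2 * Real.sin θ ^ 2) +
      k ^ 2 * Real.sin θ ^ 2 * (1 - Real.sin θ ^ 2) /
        Real.sqrt (1 - k ^ 2 * Real.sin θ ^ 2) ^ 3) volume 0 (Real.pi / 2) :=
    Continuous.intervalIntegrable (Continuous.add
      (Continuous.div (by fun_prop) (by fun_prop) h1)
      (Continuous.div (by fun_prop) (by fun_prop) fun θ => pow_ne_zero _ (h1 θ))) _ _
  have i6 : IntervalIntegrable (fun θ => (1 - 2 * Real.sin θ ^ 2) *
      Real.sqrt (1 - k ^ 2 * Real.sin θ ^ 2) / (1 - a * Real.sin θ ^ 2) -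
      k ^ 2 * Real.sin θ ^ 2 * (1 - Real.sin θ ^ 2) /
        (Real.sqrt (1 - k ^ 2 * Real.sin θ ^ 2) * (1 - a * Real.sin θ ^ 2)) +
      2 * a * Real.sin θ ^ 2 * (1 - Real.sin θ ^ 2) * Real.sqrt (1 - k ^ 2 * Real.sin θ ^ 2) /
        (1 - a * Real.sin θ ^ 2) ^ 2) volume 0 (Real.pi / 2) :=
    (Continuous.add (Continuous.sub
      (Continuous.div (by fun_prop) (by fun_prop) h2)
      (Continuous.div (by fun_prop) (by fun_prop) fun θ => mul_ne_zero (h1 θ) (h2 θ)))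
      (Continuous.div (by fun_prop) (by fun_prop) fun θ =>
        pow_ne_zero _ (h2 θ))).intervalIntegrable _ _
  have j5 := intervalIntegral.integral_eq_sub_of_hasDerivAt
    (fun θ _ => hasDerivAt_sin_mul_cos_div_sqrt hk θ) i5
  have j6 := intervalIntegral.integral_eq_sub_of_hasDerivAt
    (fun θ _ => hasDerivAt_sin_mul_cos_mul_sqrt_div hk ha θ) i6
  simp only [Real.sin_zero, Real.cos_pi_div_two, mul_zero, zero_mul, zero_div, sub_zero] at j5 j6
  have key : ∫ θ in (0 : ℝ)..(Real.pi / 2), (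
      2 * a * (1 - a) * (a - k ^ 2) * (1 - k ^ 2) *
        (a' * Real.sin θ ^ 2 / ((1 - a * Real.sin θ ^ 2) ^ 2 *
          Real.sqrt (1 - k ^ 2 * Real.sin θ ^ 2)) + k * Real.sin θ ^ 2 /
          ((1 - a * Real.sin θ ^ 2) * Real.sqrt (1 - k ^ 2 * Real.sin θ ^ 2) ^ 3)) -
      (2 * k * a * (1 - a) * (1 - k ^ 2) + a' * (a ^ 2 - k ^ 2) * (1 - k ^ 2)) *
        (1 / ((1 - a * Real.sin θ ^ 2) * Real.sqrt (1 - k ^ 2 * Real.sin θ ^ 2))) -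
      (a' * a * (1 - k ^ 2) - 2 * k * a * (1 - a)) * Real.sqrt (1 - k ^ 2 * Real.sin θ ^ 2) +
      a' * (a - k ^ 2) * (1 - k ^ 2) * (1 / Real.sqrt (1 - k ^ 2 * Real.sin θ ^ 2))) = 0 := by
    have hz := congrArg₂ (fun x y => 2 * k ^ 3 * a * (1 - a) * x - a ^ 2 * a' * (1 - k ^ 2) * y)
      j5 j6
    beta_reduce at hz
    rw [← intervalIntegral.integral_const_mul, ← intervalIntegral.integral_const_mul,
      ← intervalIntegral.integral_sub (i5.const_mul _) (i6.const_mul _), mul_zero, mul_zero,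
      sub_zero] at hz
    refine Eq.trans ?_ hz
    refine intervalIntegral.integral_congr fun θ _ => ?_
    have e1 := h1 θ
    have e2 := h2 θ
    have h3 := Real.sq_sqrt (one_sub_sq_mul_sin_sq_pos hk θ).le
    generalize √(1 - k ^ 2 * Real.sin θ ^ 2) = D at e1 h3 ⊢
    generalize Real.sin θ ^ 2 = u at e2 h3 ⊢
    field_simp
    have h4 : D ^ 4 = (1 - k ^ 2 * u) ^ 2 := by rw [← h3]; ring
    ring_nf
    simp only [h4, h3]
    ring
  rw [intervalIntegral.integral_add (((i4.const_mul _).sub (i3.const_mul _)).sub (i1.const_mul _))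
    (i2.const_mul _),
    intervalIntegral.integral_sub ((i4.const_mul _).sub (i3.const_mul _)) (i1.const_mul _),
    intervalIntegral.integral_sub (i4.const_mul _) (i3.const_mul _),
    intervalIntegral.integral_const_mul, intervalIntegral.integral_const_mul,
    intervalIntegral.integral_const_mul, intervalIntegral.integral_const_mul] at key
  rw [Ec_eq_integral, Kc_eq_integral, Pic_eq_integral]
  linarith

/-! ### The complex square root of `1 - w²` on the slit domain -/

/-- The union of the open upper half plane and the vertical strip `|Re w| < 1`. -/
def slitDomain : Set ℂ := {w | 0 < w.im ∨ |w.re| < 1}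

/-- The branch of `√(1 - w²)` that is holomorphic on `slitDomain` and continuous on the closed
upper half plane. -/
noncomputable def sqrtOneSubSq (w : ℂ) : ℂ :=
  (I * (1 - w)) ^ (2⁻¹ : ℂ) * (-I * (1 + w)) ^ (2⁻¹ : ℂ)

theorem isOpen_slitDomain : IsOpen slitDomain :=
  (isOpen_lt continuous_const continuous_im).union
    (isOpen_lt (continuous_re.abs) continuous_const)

theorem ofReal_mem_slitDomain {k : ℝ} (hk : k ∈ Ioo (-1 : ℝ) 1) : (k : ℂ) ∈ slitDomain :=
  Or.inr (by simpa using abs_lt.2 hk)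

theorem mul_ofReal_mem_slitDomain {k : ℂ} (hk : k ∈ slitDomain) {z : ℝ} (hz : z ∈ Icc (0 : ℝ) 1) :
    k * z ∈ slitDomain := by
  rcases hz.1.eq_or_lt with rfl | h
  · right; simp
  · rcases hk with hk | hk
    · left; simpa using mul_pos hk h
    · right
      simp only [mul_re, ofReal_re, ofReal_im, mul_zero, sub_zero, abs_mul, abs_of_pos h]
      nlinarith [abs_nonneg k.re, hz.2]

theorem sqrtOneSubSq_sq (w : ℂ) : sqrtOneSubSq w ^ 2 = 1 - w ^ 2 := by
  have h : ∀ a : ℂ, (a ^ (2⁻¹ : ℂ)) ^ 2 = a := fun a => by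
    simp
  rw [sqrtOneSubSq, mul_pow, h, h]
  linear_combination (-(1 - w ^ 2)) * I_sq

theorem mem_slitPlane_of_mem_slitDomain {w : ℂ} (hw : w ∈ slitDomain) :
    I * (1 - w) ∈ slitPlane ∧ -I * (1 + w) ∈ slitPlane := by
  simp only [mem_slitPlane_iff, mul_re, mul_im, neg_re, neg_im, I_re, I_im, sub_re, sub_im, add_re,
    add_im, one_re, one_im]
  rcases hw with hw | hw
  · constructor <;> left <;> linarith
  · rw [abs_lt] at hw
    constructor <;> right <;> intro h <;> linarith

theorem sqrtOneSubSq_ne_zero {w : ℂ} (hw : w ∈ slitDomain) : sqrtOneSubSq w ≠ 0 := by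
  obtain ⟨h1, h2⟩ := mem_slitPlane_of_mem_slitDomain hw
  exact mul_ne_zero (fun h => slitPlane_ne_zero h1 ((cpow_eq_zero_iff _ _).1 h).1)
    fun h => slitPlane_ne_zero h2 ((cpow_eq_zero_iff _ _).1 h).1

theorem hasDerivAt_sqrtOneSubSq {w : ℂ} (hw : w ∈ slitDomain) :
    HasDerivAt sqrtOneSubSq (-w / sqrtOneSubSq w) w := by
  obtain ⟨h1, h2⟩ := mem_slitPlane_of_mem_slitDomain hw
  have hd : DifferentiableAt ℂ sqrtOneSubSq w := by
    refine DifferentiableAt.mul ?_ ?_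
    · exact DifferentiableAt.cpow (by fun_prop) (by fun_prop) h1
    · exact DifferentiableAt.cpow (by fun_prop) (by fun_prop) h2
  have h3 : HasDerivAt (fun w => 1 - w ^ 2) (-(2 * w)) w := by
    simpa using ((hasDerivAt_id w).pow 2).const_sub (1 : ℂ)
  have h4 := hd.hasDerivAt.pow 2
  rw [show sqrtOneSubSq ^ 2 = fun w => 1 - w ^ 2 from funext sqrtOneSubSq_sq] at h4
  have h5 := h4.unique h3
  refine hd.hasDerivAt.congr_deriv ?_
  rw [eq_div_iff (sqrtOneSubSq_ne_zero hw)]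
  simp only [Nat.cast_ofNat, Nat.add_one_sub_one, pow_one] at h5
  linear_combination h5 / 2

theorem continuousOn_sqrtOneSubSq_slitDomain : ContinuousOn sqrtOneSubSq slitDomain :=
  fun _ hw => (hasDerivAt_sqrtOneSubSq hw).continuousAt.continuousWithinAt

theorem continuousAt_sqrtOneSubSq {w : ℂ} (hw : 0 ≤ w.im) : ContinuousAt sqrtOneSubSq w := by
  refine ContinuousAt.mul ?_ ?_
  · exact ContinuousAt.comp (f := fun w : ℂ => I * (1 - w)) (g := fun a : ℂ => a ^ (2⁻¹ : ℂ))
      (continuousAt_cpow_const_of_re_pos (Or.inl (by simpa using hw)) (by norm_num)) (by fun_prop)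
  · exact ContinuousAt.comp (f := fun w : ℂ => -I * (1 + w)) (g := fun a : ℂ => a ^ (2⁻¹ : ℂ))
      (continuousAt_cpow_const_of_re_pos (Or.inl (by simpa using hw)) (by norm_num)) (by fun_prop)

theorem abs_im_cpow_half_le {a : ℂ} (ha : 0 ≤ a.re) :
    |(a ^ (2⁻¹ : ℂ)).im| ≤ (a ^ (2⁻¹ : ℂ)).re := by
  have h : (a ^ (2⁻¹ : ℂ)) ^ 2 = a := by
    simp
  have h0 : 0 ≤ (a ^ (2⁻¹ : ℂ)).re := by
    rw [cpow_inv_two_re]; positivity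
  refine abs_le_of_sq_le_sq ?_ h0
  rw [← h] at ha
  simp only [sq, mul_re] at ha ⊢
  linarith

theorem sqrtOneSubSq_re_nonneg {w : ℂ} (hw : 0 ≤ w.im) : 0 ≤ (sqrtOneSubSq w).re := by
  have h1 := abs_im_cpow_half_le (a := I * (1 - w)) (by simpa using hw)
  have h2 := abs_im_cpow_half_le (a := -I * (1 + w)) (by simpa using hw)
  rw [sqrtOneSubSq, mul_re, sub_nonneg]
  refine (le_abs_self _).trans ?_
  rw [abs_mul]
  exact mul_le_mul h1 h2 (abs_nonneg _) ((abs_nonneg _).trans h1)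

theorem sqrtOneSubSq_re_mul_im (w : ℂ) :
    (sqrtOneSubSq w).re * (sqrtOneSubSq w).im = -(w.re * w.im) := by
  have h := congrArg im (sqrtOneSubSq_sq w)
  simp only [sq, mul_im, sub_im, one_im] at h
  linarith

theorem sqrtOneSubSq_re_sq_sub (w : ℂ) :
    (sqrtOneSubSq w).re ^ 2 - (sqrtOneSubSq w).im ^ 2 = 1 - (w.re ^ 2 - w.im ^ 2) := by
  have h := congrArg re (sqrtOneSubSq_sq w)
  simp only [sq, mul_re, sub_re, one_re] at h ⊢
  linarith

theorem sqrtOneSubSq_re_pos {w : ℂ} (hw : 0 ≤ w.im) (hw' : w ∈ slitDomain) :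
    0 < (sqrtOneSubSq w).re := by
  refine (sqrtOneSubSq_re_nonneg hw).lt_of_ne' fun h => ?_
  have h1 := sqrtOneSubSq_re_mul_im w
  have h2 := sqrtOneSubSq_re_sq_sub w
  rw [h] at h1 h2
  have h3 : w.re * w.im = 0 := by linarith
  rcases mul_eq_zero.1 h3 with h3 | h3
  · rw [h3] at h2
    nlinarith [sq_nonneg w.im, sq_nonneg (sqrtOneSubSq w).im]
  · rcases hw' with hw' | hw'
    · linarith
    · rw [h3] at h2
      nlinarith [sq_nonneg (sqrtOneSubSq w).im, abs_nonneg w.re, sq_abs w.re]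

theorem sqrtOneSubSq_ofReal {k : ℝ} (hk : k ∈ Ioo (-1 : ℝ) 1) :
    sqrtOneSubSq k = (Real.sqrt (1 - k ^ 2) : ℝ) := by
  have h0 := sqrtOneSubSq_re_pos (w := k) (by simp) (ofReal_mem_slitDomain hk)
  have h1 := sqrtOneSubSq_re_mul_im k
  have h2 := sqrtOneSubSq_re_sq_sub k
  simp only [ofReal_re, ofReal_im, mul_zero, neg_zero, mul_eq_zero, h0.ne', false_or] at h1
  refine Complex.ext ?_ (by simpa using h1)
  rw [ofReal_re, eq_comm, Real.sqrt_eq_iff_mul_self_eq_of_pos h0]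
  simp only [h1, ofReal_re, ofReal_im] at h2
  linarith

theorem sqrtOneSubSq_re_mul_im_nonpos {w : ℂ} (hw : 0 ≤ w.im) :
    w.re * (sqrtOneSubSq w).im ≤ 0 := by
  have hpos : ∀ w : ℂ, 0 < w.im → w.re * (sqrtOneSubSq w).im ≤ 0 := by
    intro w hw
    have h0 := sqrtOneSubSq_re_pos hw.le (Or.inl hw)
    have h1 := sqrtOneSubSq_re_mul_im w
    have : (sqrtOneSubSq w).re * (w.re * (sqrtOneSubSq w).im) ≤ 0 := by
      have : (sqrtOneSubSq w).re * (w.re * (sqrtOneSubSq w).im) = -(w.re ^ 2 * w.im) := by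
        linear_combination w.re * h1
      rw [this]
      have := mul_nonneg (sq_nonneg w.re) hw.le
      linarith
    exact nonpos_of_mul_nonpos_right this h0
  have ht : Tendsto (fun ε : ℝ => w + ε * I) (𝓝[>] 0) (𝓝 w) := by
    have : Continuous (fun ε : ℝ => w + ε * I) := by fun_prop
    simpa using (this.tendsto 0).mono_left nhdsWithin_le_nhds
  have ht2 := ((continuous_re.continuousAt.mul
    (continuous_im.continuousAt.comp (continuousAt_sqrtOneSubSq hw))).tendsto).comp ht
  refine le_of_tendsto ht2 ?_
  filter_upwards [self_mem_nhdsWithin] with ε hε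
  have : (0 : ℝ) < ε := hε
  exact hpos _ (by simp only [add_im, mul_im, ofReal_re, ofReal_im, I_re, I_im]; linarith)

theorem norm_sqrtOneSubSq_sq_le (w : ℂ) : ‖sqrtOneSubSq w‖ ^ 2 ≤ 1 + ‖w‖ ^ 2 := by
  rw [← norm_pow, sqrtOneSubSq_sq]
  refine (norm_sub_le _ _).trans ?_
  simp

/-! ### Holomorphic continuation of the complete elliptic integrals -/

/-- Continuation of the complete elliptic integral of the second kind. -/
noncomputable def ellipticE (k : ℂ) : ℂ :=
  ∫ θ in (0 : ℝ)..(Real.pi / 2), sqrtOneSubSq (k * (Real.sin θ : ℝ))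

/-- Continuation of the complete elliptic integral of the first kind. -/
noncomputable def ellipticK (k : ℂ) : ℂ :=
  ∫ θ in (0 : ℝ)..(Real.pi / 2), 1 / sqrtOneSubSq (k * (Real.sin θ : ℝ))

/-- Continuation of the complete elliptic integral of the third kind, with a polynomial
parameter. -/
noncomputable def ellipticPi (μ : ℝ[X]) (k : ℂ) : ℂ :=
  ∫ θ in (0 : ℝ)..(Real.pi / 2), 1 / ((1 - aeval k μ * (Real.sin θ : ℝ) ^ 2) *
    sqrtOneSubSq (k * (Real.sin θ : ℝ)))

/-- An integral representation of `(1 - k²) K(k)` that makes sense for all `k`. -/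
noncomputable def ellipticKappa (k : ℂ) : ℂ :=
  ∫ θ in (0 : ℝ)..(Real.pi / 2), sqrtOneSubSq (k * (Real.sin θ : ℝ)) *
    (1 - 2 * k ^ 2 + 3 * k ^ 2 * (Real.sin θ : ℝ) ^ 2)

theorem sin_mem_Icc_of_mem_Icc {θ : ℝ} (hθ : θ ∈ Icc 0 (Real.pi / 2)) :
    Real.sin θ ∈ Icc (0 : ℝ) 1 :=
  ⟨Real.sin_nonneg_of_nonneg_of_le_pi hθ.1 (by linarith [hθ.2, Real.pi_pos]), Real.sin_le_one θ⟩

theorem mul_sin_mem_slitDomain {k : ℂ} (hk : k ∈ slitDomain) {θ : ℝ}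
    (hθ : θ ∈ Icc 0 (Real.pi / 2)) : k * (Real.sin θ : ℝ) ∈ slitDomain :=
  mul_ofReal_mem_slitDomain hk (sin_mem_Icc_of_mem_Icc hθ)

theorem mul_sin_mem_Ioo {k : ℝ} (hk : k ∈ Ioo (-1 : ℝ) 1) (θ : ℝ) :
    k * Real.sin θ ∈ Ioo (-1 : ℝ) 1 := by
  rw [mem_Ioo, ← abs_lt] at *
  rw [abs_mul]
  nlinarith [Real.abs_sin_le_one θ, abs_nonneg k, abs_nonneg (Real.sin θ)]

theorem sqrtOneSubSq_ofReal_mul_sin {k : ℝ} (hk : k ∈ Ioo (-1 : ℝ) 1) (θ : ℝ) :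
    sqrtOneSubSq (k * (Real.sin θ : ℝ)) = (Real.sqrt (1 - k ^ 2 * Real.sin θ ^ 2) : ℝ) := by
  rw [← ofReal_mul, sqrtOneSubSq_ofReal (mul_sin_mem_Ioo hk θ), mul_pow]

theorem ellipticE_ofReal {k : ℝ} (hk : k ∈ Ioo (-1 : ℝ) 1) : ellipticE k = (Ec k : ℝ) := by
  rw [ellipticE, Ec_eq_integral, ← intervalIntegral.integral_ofReal]
  exact intervalIntegral.integral_congr fun θ _ => sqrtOneSubSq_ofReal_mul_sin hk θ

theorem ellipticK_ofReal {k : ℝ} (hk : k ∈ Ioo (-1 : ℝ) 1) : ellipticK k = (Kc k : ℝ) := by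
  rw [ellipticK, Kc_eq_integral, ← intervalIntegral.integral_ofReal]
  exact intervalIntegral.integral_congr fun θ _ => by
    simp [← sqrtOneSubSq_ofReal_mul_sin hk θ]

theorem ellipticPi_ofReal (μ : ℝ[X]) {k : ℝ} (hk : k ∈ Ioo (-1 : ℝ) 1) :
    ellipticPi μ k = (Pic (μ.eval k) k : ℝ) := by
  rw [ellipticPi, Pic_eq_integral, ← intervalIntegral.integral_ofReal]
  refine intervalIntegral.integral_congr fun θ _ => ?_
  have : aeval (k : ℂ) μ = (μ.eval k : ℝ) := by
    simpa using aeval_algebraMap_apply_eq_algebraMap_eval (A := ℂ) k μ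
  simp only [this, sqrtOneSubSq_ofReal_mul_sin hk θ]
  push_cast
  rfl

theorem continuousOn_sqrtOneSubSq_mul_sin : ContinuousOn
    (fun p : ℂ × ℝ => sqrtOneSubSq (p.1 * (Real.sin p.2 : ℝ)))
    (slitDomain ×ˢ Icc 0 (Real.pi / 2)) :=
  continuousOn_sqrtOneSubSq_slitDomain.comp (by fun_prop)
    fun _ hp => mul_sin_mem_slitDomain hp.1 hp.2

theorem hasDerivAt_sqrtOneSubSq_mul {k : ℂ} {z : ℂ} (h : k * z ∈ slitDomain) :
    HasDerivAt (fun k => sqrtOneSubSq (k * z)) (-(k * z ^ 2) / sqrtOneSubSq (k * z)) k := by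
  have h1 := (hasDerivAt_sqrtOneSubSq h).comp (h₂ := sqrtOneSubSq) (h := fun k => k * z) k
    ((hasDerivAt_id k).mul_const z)
  refine h1.congr_deriv ?_
  ring

theorem sqrtOneSubSq_mul_sin_ne_zero {k : ℂ} (hk : k ∈ slitDomain) {θ : ℝ}
    (hθ : θ ∈ Icc 0 (Real.pi / 2)) : sqrtOneSubSq (k * (Real.sin θ : ℝ)) ≠ 0 :=
  sqrtOneSubSq_ne_zero (mul_sin_mem_slitDomain hk hθ)

theorem differentiableOn_ellipticE : DifferentiableOn ℂ ellipticE slitDomain := by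
  intro k hk
  have hc := continuousOn_sqrtOneSubSq_mul_sin
  exact (hasDerivAt_intervalIntegral_of_continuousOn
    (F := fun (k : ℂ) (θ : ℝ) => sqrtOneSubSq (k * (Real.sin θ : ℝ)))
    (F' := fun k θ => -(k * ((Real.sin θ : ℝ) : ℂ) ^ 2) / sqrtOneSubSq (k * (Real.sin θ : ℝ)))
    isOpen_slitDomain (a := 0) (b := Real.pi / 2) (by positivity) hc
    (ContinuousOn.div (by fun_prop) hc fun p hp => sqrtOneSubSq_mul_sin_ne_zero hp.1 hp.2)
    (fun x hx t ht => hasDerivAt_sqrtOneSubSq_mul (mul_sin_mem_slitDomain hx ht))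
    hk).differentiableAt.differentiableWithinAt

theorem differentiableOn_ellipticPi (μ : ℝ[X]) :
    DifferentiableOn ℂ (ellipticPi μ) (slitDomain ∩ {k | ‖aeval k μ‖ < 1}) := by
  intro k hk
  have hμc : Continuous fun k : ℂ => aeval k μ := μ.continuous_aeval
  have hμc' : Continuous fun k : ℂ => aeval k (derivative μ) := (derivative μ).continuous_aeval
  have hc := continuousOn_sqrtOneSubSq_mul_sin.mono (t := (slitDomain ∩ {k | ‖aeval k μ‖ < 1}) ×ˢ
    Icc 0 (Real.pi / 2)) (prod_mono_left inter_subset_left)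
  have hne : ∀ k ∈ slitDomain ∩ {k : ℂ | ‖aeval k μ‖ < 1}, ∀ θ ∈ Icc 0 (Real.pi / 2),
      (1 - aeval k μ * (Real.sin θ : ℝ) ^ 2) * sqrtOneSubSq (k * (Real.sin θ : ℝ)) ≠ 0 := by
    intro k hk θ hθ
    refine mul_ne_zero (fun h => ?_) (sqrtOneSubSq_mul_sin_ne_zero hk.1 hθ)
    have h1 : ‖aeval k μ * ((Real.sin θ : ℝ) : ℂ) ^ 2‖ = 1 := by
      rw [← sub_eq_zero.1 h, norm_one]
    rw [norm_mul, norm_pow, norm_real, Real.norm_eq_abs, sq_abs] at h1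
    have h2 : ‖aeval k μ‖ < 1 := hk.2
    nlinarith [Real.sin_sq_le_one θ, norm_nonneg (aeval k μ)]
  exact (hasDerivAt_intervalIntegral_of_continuousOn
    (F := fun (k : ℂ) (θ : ℝ) => 1 / ((1 - aeval k μ * (Real.sin θ : ℝ) ^ 2) *
      sqrtOneSubSq (k * (Real.sin θ : ℝ))))
    (F' := fun k θ => -(-(aeval k (derivative μ) * (Real.sin θ : ℝ) ^ 2) *
        sqrtOneSubSq (k * (Real.sin θ : ℝ)) + (1 - aeval k μ * (Real.sin θ : ℝ) ^ 2) *
        (-(k * ((Real.sin θ : ℝ) : ℂ) ^ 2) / sqrtOneSubSq (k * (Real.sin θ : ℝ)))) /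
      ((1 - aeval k μ * (Real.sin θ : ℝ) ^ 2) * sqrtOneSubSq (k * (Real.sin θ : ℝ))) ^ 2)
    (isOpen_slitDomain.inter (isOpen_lt hμc.norm continuous_const))
    (a := 0) (b := Real.pi / 2) (by positivity)
    (ContinuousOn.div (by fun_prop) (by fun_prop) fun p hp => hne _ hp.1 _ hp.2)
    (ContinuousOn.div (ContinuousOn.neg (ContinuousOn.add (by fun_prop) (ContinuousOn.mul
      (by fun_prop) (ContinuousOn.div (by fun_prop) hc
        fun p hp => sqrtOneSubSq_mul_sin_ne_zero hp.1.1 hp.2)))) (by fun_prop)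
      fun p hp => pow_ne_zero _ (hne _ hp.1 _ hp.2))
    (fun x hx t ht => by
      have h := ((((μ.hasDerivAt_aeval x).mul_const (((Real.sin t : ℝ) : ℂ) ^ 2)).const_sub 1).mul
        (hasDerivAt_sqrtOneSubSq_mul (mul_sin_mem_slitDomain hx.1 ht))).inv (hne x hx t ht)
      simp only [one_div]
      exact h)
    hk).differentiableAt.differentiableWithinAt

theorem ellipticK_eq_ellipticPi : ellipticK = ellipticPi 0 := by
  funext k
  simp [ellipticK, ellipticPi]

theorem differentiableOn_ellipticK : DifferentiableOn ℂ ellipticK slitDomain := by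
  rw [ellipticK_eq_ellipticPi]
  exact (differentiableOn_ellipticPi 0).mono fun k hk => ⟨hk, by simp⟩

theorem analyticAt_of_eq_ofReal {f : ℝ → ℝ} {F : ℂ → ℂ} {U : Set ℂ} (hU : IsOpen U)
    (hF : DifferentiableOn ℂ F U) (h : ∀ k ∈ Ioo (-1 : ℝ) 1, (k : ℂ) ∈ U ∧ F k = f k) {k : ℝ}
    (hk : k ∈ Ioo (-1 : ℝ) 1) : AnalyticAt ℝ f k := by
  have h1 : AnalyticAt ℂ F k := hF.analyticAt (hU.mem_nhds (h k hk).1)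
  refine h1.re_ofReal.congr ?_
  filter_upwards [isOpen_Ioo.mem_nhds hk] with x hx
  simp [(h x hx).2]

theorem analyticAt_Ec {k : ℝ} (hk : k ∈ Ioo (-1 : ℝ) 1) : AnalyticAt ℝ Ec k :=
  analyticAt_of_eq_ofReal isOpen_slitDomain differentiableOn_ellipticE
    (fun _ hk => ⟨ofReal_mem_slitDomain hk, ellipticE_ofReal hk⟩) hk

theorem analyticAt_Kc {k : ℝ} (hk : k ∈ Ioo (-1 : ℝ) 1) : AnalyticAt ℝ Kc k :=
  analyticAt_of_eq_ofReal isOpen_slitDomain differentiableOn_ellipticK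
    (fun _ hk => ⟨ofReal_mem_slitDomain hk, ellipticK_ofReal hk⟩) hk

theorem analyticAt_Pic {μ : ℝ[X]} (hμ : ∀ k ∈ Ioo (-1 : ℝ) 1, |μ.eval k| < 1) {k : ℝ}
    (hk : k ∈ Ioo (-1 : ℝ) 1) : AnalyticAt ℝ (fun k => Pic (μ.eval k) k) k :=
  analyticAt_of_eq_ofReal
    (isOpen_slitDomain.inter (isOpen_lt μ.continuous_aeval.norm continuous_const))
    (differentiableOn_ellipticPi μ)
    (fun k hk => ⟨⟨ofReal_mem_slitDomain hk, by
      have : aeval (k : ℂ) μ = (μ.eval k : ℝ) := by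
        simpa using aeval_algebraMap_apply_eq_algebraMap_eval (A := ℂ) k μ
      simpa [this] using hμ k hk⟩, ellipticPi_ofReal μ hk⟩) hk

theorem ellipticKappa_eq {k : ℂ} (hk : k ∈ slitDomain) :
    ellipticKappa k = (1 - k ^ 2) * ellipticK k := by
  have hc : ContinuousOn (fun θ : ℝ => sqrtOneSubSq (k * (Real.sin θ : ℝ)))
      (uIcc 0 (Real.pi / 2)) := by
    rw [uIcc_of_le (by positivity)]
    exact continuousOn_sqrtOneSubSq_mul_sin.comp (f := fun θ : ℝ => (k, θ)) (by fun_prop)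
      fun θ hθ => ⟨hk, hθ⟩
  have hne : ∀ θ ∈ uIcc 0 (Real.pi / 2), sqrtOneSubSq (k * (Real.sin θ : ℝ)) ≠ 0 := by
    rw [uIcc_of_le (by positivity)]
    exact fun θ hθ => sqrtOneSubSq_mul_sin_ne_zero hk hθ
  have hprim : ∀ θ ∈ uIcc 0 (Real.pi / 2), HasDerivAt
      (fun θ : ℝ => sqrtOneSubSq (k * (Real.sin θ : ℝ)) * ((Real.sin θ * Real.cos θ : ℝ) : ℂ))
      ((1 - 2 * (Real.sin θ : ℝ) ^ 2) * sqrtOneSubSq (k * (Real.sin θ : ℝ)) -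
        k ^ 2 * (Real.sin θ : ℝ) ^ 2 * (1 - (Real.sin θ : ℝ) ^ 2) /
          sqrtOneSubSq (k * (Real.sin θ : ℝ))) θ := by
    intro θ hθ
    have h1 := hne θ hθ
    have h2 := ((Real.hasDerivAt_sin θ).mul (Real.hasDerivAt_cos θ)).ofReal_comp
    rw [uIcc_of_le (by positivity)] at hθ
    have h3 := (hasDerivAt_sqrtOneSubSq (mul_sin_mem_slitDomain hk hθ)).comp_of_eq θ
      (h₂ := sqrtOneSubSq) (h := fun θ : ℝ => k * ((Real.sin θ : ℝ) : ℂ))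
      ((Real.hasDerivAt_sin θ).ofReal_comp.const_mul k) rfl
    refine (h3.mul h2).congr_deriv ?_
    have h4 : ((Real.cos θ : ℝ) : ℂ) ^ 2 = 1 - ((Real.sin θ : ℝ) : ℂ) ^ 2 := by
      rw [← ofReal_pow, Real.cos_sq']; push_cast; ring
    simp only [Function.comp_apply, Pi.mul_apply]
    push_cast only [ofReal_add, ofReal_mul, ofReal_neg]
    generalize sqrtOneSubSq (k * (Real.sin θ : ℝ)) = s at h1 ⊢
    field_simp
    rw [h4]
    ring
  have i1 : IntervalIntegrable (fun θ : ℝ => (1 - 2 * ((Real.sin θ : ℝ) : ℂ) ^ 2) *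
      sqrtOneSubSq (k * (Real.sin θ : ℝ)) -
        k ^ 2 * (Real.sin θ : ℝ) ^ 2 * (1 - (Real.sin θ : ℝ) ^ 2) /
          sqrtOneSubSq (k * (Real.sin θ : ℝ))) volume 0 (Real.pi / 2) :=
    (ContinuousOn.sub (ContinuousOn.mul (by fun_prop) hc)
      (ContinuousOn.div (by fun_prop) hc hne)).intervalIntegrable
  have i2 : IntervalIntegrable (fun θ : ℝ => 1 / sqrtOneSubSq (k * (Real.sin θ : ℝ)))
      volume 0 (Real.pi / 2) :=
    (ContinuousOn.div (by fun_prop) hc hne).intervalIntegrable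
  have hprimitive := intervalIntegral.integral_eq_sub_of_hasDerivAt hprim i1
  simp only [Real.sin_zero, Real.cos_pi_div_two, mul_zero, zero_mul, sub_zero, ofReal_zero] at hprimitive
  have hz := congrArg (fun x => (1 - k ^ 2) * ellipticK k - k ^ 2 * x) hprimitive
  beta_reduce at hz
  rw [mul_zero, sub_zero, ellipticK, ← intervalIntegral.integral_const_mul,
    ← intervalIntegral.integral_const_mul,
    ← intervalIntegral.integral_sub (i2.const_mul _) (i1.const_mul _)] at hz
  rw [ellipticK, ← intervalIntegral.integral_const_mul, ← hz, ellipticKappa]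
  refine intervalIntegral.integral_congr fun θ hθ => ?_
  have h1 := hne θ hθ
  have h2 := sqrtOneSubSq_sq (k * (Real.sin θ : ℝ))
  generalize sqrtOneSubSq (k * (Real.sin θ : ℝ)) = s at h1 h2 ⊢
  field_simp
  rw [h2]
  ring

theorem continuous_sqrtOneSubSq_max :
    Continuous fun w : ℂ => sqrtOneSubSq (w.re + (max w.im 0 : ℝ) * I) := by
  refine continuous_iff_continuousAt.2 fun w => ?_
  refine ContinuousAt.comp (f := fun w : ℂ => (w.re + (max w.im 0 : ℝ) * I : ℂ))
    (continuousAt_sqrtOneSubSq (by simp)) (by fun_prop)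

theorem sqrtOneSubSq_max {w : ℂ} (hw : 0 ≤ w.im) :
    sqrtOneSubSq (w.re + (max w.im 0 : ℝ) * I) = sqrtOneSubSq w := by
  rw [max_eq_left hw, re_add_im]

theorem mul_sin_im_nonneg {k : ℂ} (hk : 0 ≤ k.im) {θ : ℝ} (hθ : θ ∈ Icc 0 (Real.pi / 2)) :
    0 ≤ (k * (Real.sin θ : ℝ)).im := by
  rw [im_mul_ofReal]
  exact mul_nonneg hk (sin_mem_Icc_of_mem_Icc hθ).1

theorem continuousOn_integral_sqrtOneSubSq_mul {g : ℂ → ℝ → ℂ}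
    (hg : Continuous fun p : ℂ × ℝ => g p.1 p.2) : ContinuousOn
    (fun k : ℂ => ∫ θ in (0 : ℝ)..(Real.pi / 2), sqrtOneSubSq (k * (Real.sin θ : ℝ)) * g k θ)
    {k | 0 ≤ k.im} := by
  have h := intervalIntegral.continuous_parametric_intervalIntegral_of_continuous' (μ := volume)
    (f := fun (k : ℂ) (θ : ℝ) => sqrtOneSubSq ((k * (Real.sin θ : ℝ)).re +
      (max (k * (Real.sin θ : ℝ)).im 0 : ℝ) * I) * g k θ)
    (Continuous.mul (continuous_sqrtOneSubSq_max.comp (g := fun w : ℂ =>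
      sqrtOneSubSq (w.re + (max w.im 0 : ℝ) * I))
      (f := fun p : ℂ × ℝ => p.1 * (Real.sin p.2 : ℝ)) (by fun_prop)) hg) 0 (Real.pi / 2)
  refine h.continuousOn.congr fun k hk => ?_
  refine intervalIntegral.integral_congr fun θ hθ => ?_
  rw [uIcc_of_le (by positivity)] at hθ
  simp only [sqrtOneSubSq_max (mul_sin_im_nonneg hk hθ)]

theorem continuousOn_ellipticE : ContinuousOn ellipticE {k | 0 ≤ k.im} := by
  unfold ellipticE
  simpa only [mul_one] using continuousOn_integral_sqrtOneSubSq_mul (g := fun _ _ => 1)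
    continuous_const

theorem continuousOn_ellipticKappa : ContinuousOn ellipticKappa {k | 0 ≤ k.im} :=
  continuousOn_integral_sqrtOneSubSq_mul
    (g := fun k θ => 1 - 2 * k ^ 2 + 3 * k ^ 2 * (Real.sin θ : ℝ) ^ 2) (by fun_prop)

/-! ### The ratio of the elliptic integrals in the closed upper half plane -/

theorem continuousOn_sqrtOneSubSq_mul_sin_of_im_nonneg {k : ℂ} (hk : 0 ≤ k.im) :
    ContinuousOn (fun θ : ℝ => sqrtOneSubSq (k * (Real.sin θ : ℝ))) (Icc 0 (Real.pi / 2)) :=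
  fun θ hθ => (ContinuousAt.comp (g := sqrtOneSubSq) (f := fun θ : ℝ => k * (Real.sin θ : ℝ))
    (continuousAt_sqrtOneSubSq (mul_sin_im_nonneg hk hθ)) (by fun_prop)).continuousWithinAt

theorem intervalIntegrable_sqrtOneSubSq_mul_sin {k : ℂ} (hk : 0 ≤ k.im) :
    IntervalIntegrable (fun θ : ℝ => sqrtOneSubSq (k * (Real.sin θ : ℝ))) volume
      0 (Real.pi / 2) :=
  ContinuousOn.intervalIntegrable (by
    rw [uIcc_of_le (by positivity)]
    exact continuousOn_sqrtOneSubSq_mul_sin_of_im_nonneg hk)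

theorem intervalIntegrable_one_div_sqrtOneSubSq_mul_sin {k : ℂ} (hk : 0 < k.im) :
    IntervalIntegrable (fun θ : ℝ => 1 / sqrtOneSubSq (k * (Real.sin θ : ℝ))) volume
      0 (Real.pi / 2) :=
  ContinuousOn.intervalIntegrable (by
    rw [uIcc_of_le (by positivity)]
    exact continuousOn_const.div (continuousOn_sqrtOneSubSq_mul_sin_of_im_nonneg hk.le)
      fun θ hθ => sqrtOneSubSq_mul_sin_ne_zero (Or.inl hk) hθ)

theorem IntervalIntegrable.re_complex {f : ℝ → ℂ} {a b : ℝ} (h : IntervalIntegrable f volume a b) :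
    IntervalIntegrable (fun x => (f x).re) volume a b :=
  ⟨reCLM.integrable_comp h.1, reCLM.integrable_comp h.2⟩

theorem IntervalIntegrable.im_complex {f : ℝ → ℂ} {a b : ℝ} (h : IntervalIntegrable f volume a b) :
    IntervalIntegrable (fun x => (f x).im) volume a b :=
  ⟨imCLM.integrable_comp h.1, imCLM.integrable_comp h.2⟩

theorem ellipticE_re_eq {k : ℂ} (hk : 0 ≤ k.im) : (ellipticE k).re =
    ∫ θ in (0 : ℝ)..(Real.pi / 2), (sqrtOneSubSq (k * (Real.sin θ : ℝ))).re :=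
  (reCLM.intervalIntegral_comp_comm (intervalIntegrable_sqrtOneSubSq_mul_sin hk)).symm

theorem ellipticE_im_eq {k : ℂ} (hk : 0 ≤ k.im) : (ellipticE k).im =
    ∫ θ in (0 : ℝ)..(Real.pi / 2), (sqrtOneSubSq (k * (Real.sin θ : ℝ))).im :=
  (imCLM.intervalIntegral_comp_comm (intervalIntegrable_sqrtOneSubSq_mul_sin hk)).symm

theorem ellipticK_re_eq {k : ℂ} (hk : 0 < k.im) : (ellipticK k).re =
    ∫ θ in (0 : ℝ)..(Real.pi / 2), (1 / sqrtOneSubSq (k * (Real.sin θ : ℝ))).re :=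
  (reCLM.intervalIntegral_comp_comm (intervalIntegrable_one_div_sqrtOneSubSq_mul_sin hk)).symm

theorem ellipticK_im_eq {k : ℂ} (hk : 0 < k.im) : (ellipticK k).im =
    ∫ θ in (0 : ℝ)..(Real.pi / 2), (1 / sqrtOneSubSq (k * (Real.sin θ : ℝ))).im :=
  (imCLM.intervalIntegral_comp_comm (intervalIntegrable_one_div_sqrtOneSubSq_mul_sin hk)).symm

theorem ellipticE_re_pos {k : ℂ} (hk : 0 ≤ k.im) : 0 < (ellipticE k).re := by
  rw [ellipticE_re_eq hk]
  refine intervalIntegral.integral_pos (by positivity)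
    (continuous_re.comp_continuousOn (continuousOn_sqrtOneSubSq_mul_sin_of_im_nonneg hk))
    (fun θ hθ => sqrtOneSubSq_re_nonneg (mul_sin_im_nonneg hk (Ioc_subset_Icc_self hθ)))
    ⟨0, by constructor <;> positivity, ?_⟩
  exact sqrtOneSubSq_re_pos (by simp) (Or.inr (by simp))

theorem re_mul_sqrtOneSubSq_mul_sin_im_nonpos {k : ℂ} (hk : 0 ≤ k.im) {θ : ℝ}
    (hθ : θ ∈ Icc 0 (Real.pi / 2)) :
    k.re * (sqrtOneSubSq (k * (Real.sin θ : ℝ))).im ≤ 0 := by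
  rcases (sin_mem_Icc_of_mem_Icc hθ).1.eq_or_lt with h | h
  · rw [← h]
    have : sqrtOneSubSq ((0 : ℝ) : ℂ) = _ := sqrtOneSubSq_ofReal (by norm_num)
    simp only [ofReal_zero] at this
    simp [this]
  · have h1 := sqrtOneSubSq_re_mul_im_nonpos (mul_sin_im_nonneg hk hθ)
    rw [re_mul_ofReal, mul_right_comm] at h1
    exact nonpos_of_mul_nonpos_left h1 h

theorem re_mul_ellipticE_im_nonpos {k : ℂ} (hk : 0 ≤ k.im) : k.re * (ellipticE k).im ≤ 0 := by
  rw [ellipticE_im_eq hk, ← intervalIntegral.integral_const_mul]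
  rw [← neg_nonneg, ← intervalIntegral.integral_neg]
  exact intervalIntegral.integral_nonneg (by positivity)
    fun θ hθ => neg_nonneg.2 (re_mul_sqrtOneSubSq_mul_sin_im_nonpos hk hθ)

theorem mul_ellipticE_ofReal_im_neg {t : ℝ} (ht : 1 < |t|) : t * (ellipticE t).im < 0 := by
  have h0 : 0 ≤ (t : ℂ).im := by simp
  have hpos : 0 < ∫ θ in (0 : ℝ)..(Real.pi / 2),
      -(t * (sqrtOneSubSq (t * (Real.sin θ : ℝ))).im) := by
    refine intervalIntegral.integral_pos (by positivity)
      (continuousOn_const.mul (continuous_im.comp_continuousOn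
        (continuousOn_sqrtOneSubSq_mul_sin_of_im_nonneg h0))).neg
      (fun θ hθ => neg_nonneg.2 (by
        simpa using re_mul_sqrtOneSubSq_mul_sin_im_nonpos h0 (Ioc_subset_Icc_self hθ)))
      ⟨Real.pi / 2, by constructor <;> [positivity; rfl], ?_⟩
    have h1 := re_mul_sqrtOneSubSq_mul_sin_im_nonpos h0 (θ := Real.pi / 2)
      (by constructor <;> [positivity; rfl])
    simp only [Real.sin_pi_div_two, ofReal_one, mul_one, ofReal_re] at h1 ⊢
    rw [neg_pos]
    refine h1.lt_of_ne fun h => ?_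
    have h2 := sqrtOneSubSq_re_sq_sub t
    have h3 : (sqrtOneSubSq t).im = 0 := by
      refine (mul_eq_zero.1 h).resolve_left fun h => ?_
      rw [h] at ht
      norm_num at ht
    rw [h3] at h2
    simp only [ofReal_re, ofReal_im] at h2
    nlinarith [sq_nonneg (sqrtOneSubSq t).re, sq_abs t]
  rw [intervalIntegral.integral_neg, intervalIntegral.integral_const_mul, ← ellipticE_im_eq h0]
    at hpos
  linarith

theorem norm_sqrtOneSubSq_mul_sin_sq_le (k : ℂ) (θ : ℝ) :
    normSq (sqrtOneSubSq (k * (Real.sin θ : ℝ))) ≤ 1 + ‖k‖ ^ 2 := by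
  rw [normSq_eq_norm_sq]
  refine (norm_sqrtOneSubSq_sq_le _).trans ?_
  rw [norm_mul, norm_real, mul_pow, Real.norm_eq_abs, sq_abs]
  nlinarith [Real.sin_sq_le_one θ, sq_nonneg ‖k‖]

theorem ellipticE_re_le {k : ℂ} (hk : 0 < k.im) :
    (ellipticE k).re ≤ (1 + ‖k‖ ^ 2) * (ellipticK k).re := by
  rw [ellipticE_re_eq hk.le, ellipticK_re_eq hk, ← intervalIntegral.integral_const_mul]
  refine intervalIntegral.integral_mono_on (by positivity)
    (intervalIntegrable_sqrtOneSubSq_mul_sin hk.le).re_complex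
    ((intervalIntegrable_one_div_sqrtOneSubSq_mul_sin hk).re_complex.const_mul _) fun θ hθ => ?_
  have h0 := sqrtOneSubSq_re_nonneg (mul_sin_im_nonneg hk.le hθ)
  have h1 := normSq_pos.2 (sqrtOneSubSq_mul_sin_ne_zero (k := k) (Or.inl hk) hθ)
  rw [one_div, inv_re, mul_div_assoc', le_div_iff₀ h1, mul_comm]
  exact mul_le_mul_of_nonneg_right (norm_sqrtOneSubSq_mul_sin_sq_le k θ) h0

theorem neg_re_mul_ellipticE_im_le {k : ℂ} (hk : 0 < k.im) :
    -(k.re * (ellipticE k).im) ≤ (1 + ‖k‖ ^ 2) * (k.re * (ellipticK k).im) := by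
  rw [ellipticE_im_eq hk.le, ellipticK_im_eq hk, ← intervalIntegral.integral_const_mul,
    ← intervalIntegral.integral_const_mul, ← intervalIntegral.integral_const_mul,
    ← intervalIntegral.integral_neg]
  refine intervalIntegral.integral_mono_on (by positivity)
    ((intervalIntegrable_sqrtOneSubSq_mul_sin hk.le).im_complex.const_mul _).neg
    (((intervalIntegrable_one_div_sqrtOneSubSq_mul_sin hk).im_complex.const_mul _).const_mul _) fun θ hθ => ?_
  have h0 := re_mul_sqrtOneSubSq_mul_sin_im_nonpos hk.le hθ
  have h1 := normSq_pos.2 (sqrtOneSubSq_mul_sin_ne_zero (k := k) (Or.inl hk) hθ)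
  rw [one_div, inv_im, mul_div_assoc', mul_div_assoc', le_div_iff₀ h1]
  nlinarith [norm_sqrtOneSubSq_mul_sin_sq_le k θ]

theorem ellipticK_ne_zero {k : ℂ} (hk : 0 < k.im) : ellipticK k ≠ 0 := by
  intro h
  have h1 := ellipticE_re_le hk
  have h2 := ellipticE_re_pos hk.le
  rw [h] at h1
  simp only [zero_re, mul_zero] at h1
  linarith

theorem norm_ellipticE_le {k : ℂ} (hk : 0 < k.im) :
    ‖ellipticE k‖ ≤ (1 + ‖k‖ ^ 2) * ‖ellipticK k‖ := by
  have h1 := ellipticE_re_le hk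
  have h2 := ellipticE_re_pos hk.le
  have h3 := neg_re_mul_ellipticE_im_le hk
  have h4 := re_mul_ellipticE_im_nonpos hk.le
  have hB : 0 < 1 + ‖k‖ ^ 2 := by positivity
  have him : |(ellipticE k).im| ≤ (1 + ‖k‖ ^ 2) * |(ellipticK k).im| := by
    rcases eq_or_ne k.re 0 with h0 | h0
    · have : (ellipticE k).im = 0 := by
        rw [ellipticE_im_eq hk.le]
        refine intervalIntegral.integral_zero_ae (ae_of_all _ fun θ hθ => ?_)
        rw [uIoc_of_le (by positivity)] at hθ
        have h5 := sqrtOneSubSq_re_mul_im (k * (Real.sin θ : ℝ))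
        rw [re_mul_ofReal, h0, zero_mul, zero_mul, neg_zero] at h5
        exact (mul_eq_zero.1 h5).resolve_left (sqrtOneSubSq_re_pos
          (mul_sin_im_nonneg hk.le (Ioc_subset_Icc_self hθ))
          (mul_sin_mem_slitDomain (Or.inl hk) (Ioc_subset_Icc_self hθ))).ne'
      rw [this, abs_zero]
      positivity
    · have h5 : |k.re| * |(ellipticE k).im| ≤
          |k.re| * ((1 + ‖k‖ ^ 2) * |(ellipticK k).im|) := by
        rw [← abs_mul, abs_of_nonpos h4, mul_left_comm, ← abs_mul]
        exact h3.trans (mul_le_mul_of_nonneg_left (le_abs_self _) hB.le)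
      exact le_of_mul_le_mul_left h5 (abs_pos.2 h0)
  refine abs_le_of_sq_le_sq' ?_ (by positivity) |>.2
  rw [mul_pow, ← normSq_eq_norm_sq (ellipticE k), ← normSq_eq_norm_sq (ellipticK k),
    normSq_apply, normSq_apply]
  have h6 := mul_self_le_mul_self h2.le h1
  have h7 := mul_self_le_mul_self (abs_nonneg _) him
  rw [abs_mul_abs_self, mul_mul_mul_comm, abs_mul_abs_self] at h7
  linarith

theorem neg_re_mul_im_ge {k : ℂ} (hk : 0 < k.im) :
    2 * (ellipticE k).re * (-(k.re * (ellipticE k).im)) ≤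
      (1 + ‖k‖ ^ 2) * (-(k.re * (ellipticE k * (starRingEnd ℂ) (ellipticK k)).im)) := by
  have h1 := ellipticE_re_le hk
  have h2 := ellipticE_re_pos hk.le
  have h3 := neg_re_mul_ellipticE_im_le hk
  have h4 := re_mul_ellipticE_im_nonpos hk.le
  simp only [mul_im, conj_re, conj_im]
  have h5 := mul_le_mul_of_nonneg_right h1 (neg_nonneg.2 h4)
  have h6 := mul_le_mul_of_nonneg_left h3 h2.le
  linarith

theorem le_of_im_nonneg_of_le {f g : ℂ → ℝ} (hf : ContinuousOn f {k | 0 ≤ k.im})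
    (hg : ContinuousOn g {k | 0 ≤ k.im}) (h : ∀ k : ℂ, 0 < k.im → f k ≤ g k) {k : ℂ}
    (hk : 0 ≤ k.im) : f k ≤ g k := by
  have hcl : closure {k : ℂ | 0 < k.im} = {k | 0 ≤ k.im} := closure_setOfPred_lt_im 0
  exact le_on_closure (s := {k : ℂ | 0 < k.im}) h (hcl ▸ hf) (hcl ▸ hg) (hcl ▸ hk)

theorem norm_mul_norm_ellipticE_le {k : ℂ} (hk : 0 ≤ k.im) :
    ‖1 - k ^ 2‖ * ‖ellipticE k‖ ≤ (1 + ‖k‖ ^ 2) * ‖ellipticKappa k‖ := by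
  have hE := continuousOn_ellipticE
  have hκ := continuousOn_ellipticKappa
  refine le_of_im_nonneg_of_le (f := fun k => ‖1 - k ^ 2‖ * ‖ellipticE k‖)
    (g := fun k => (1 + ‖k‖ ^ 2) * ‖ellipticKappa k‖) (by fun_prop) (by fun_prop) ?_ hk
  intro k hk
  rw [ellipticKappa_eq (Or.inl hk), norm_mul, mul_left_comm]
  exact mul_le_mul_of_nonneg_left (norm_ellipticE_le hk) (norm_nonneg _)

theorem neg_re_mul_im_kappa_ge {k : ℂ} (hk : 0 ≤ k.im) :
    2 * (ellipticE k).re * (-(k.re * (ellipticE k).im)) * ‖1 - k ^ 2‖ ^ 2 ≤ (1 + ‖k‖ ^ 2) *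
      (-(k.re * ((1 - k ^ 2) * ellipticE k * (starRingEnd ℂ) (ellipticKappa k)).im)) := by
  have hE := continuousOn_ellipticE
  have hκ := continuousOn_ellipticKappa
  refine le_of_im_nonneg_of_le
    (f := fun k => 2 * (ellipticE k).re * (-(k.re * (ellipticE k).im)) * ‖1 - k ^ 2‖ ^ 2)
    (g := fun k => (1 + ‖k‖ ^ 2) *
      (-(k.re * ((1 - k ^ 2) * ellipticE k * (starRingEnd ℂ) (ellipticKappa k)).im)))
    (by fun_prop) (by fun_prop) ?_ hk
  intro k hk
  have h := mul_le_mul_of_nonneg_right (neg_re_mul_im_ge hk) (sq_nonneg ‖1 - k ^ 2‖)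
  refine h.trans_eq ?_
  have h2 : (1 - k ^ 2) * ellipticE k * (starRingEnd ℂ) (ellipticKappa k) =
      ((‖1 - k ^ 2‖ ^ 2 : ℝ) : ℂ) * (ellipticE k * (starRingEnd ℂ) (ellipticK k)) := by
    rw [ellipticKappa_eq (Or.inl hk), map_mul, ofReal_pow, ← mul_conj']
    ring
  rw [h2, im_ofReal_mul]
  ring

/-- The ratio `E / K`, extended to the closed upper half plane. -/
noncomputable def ellipticRatio (k : ℂ) : ℂ := (1 - k ^ 2) * ellipticE k / ellipticKappa k

theorem one_sub_sq_ne_zero {k : ℂ} (hk : k ≠ 1) (hk' : k ≠ -1) : 1 - k ^ 2 ≠ 0 := by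
  rw [show 1 - k ^ 2 = (1 - k) * (1 + k) by ring]
  exact mul_ne_zero (sub_ne_zero.2 hk.symm) fun h => hk' (by linear_combination h)

theorem ellipticKappa_ne_zero {k : ℂ} (hk : 0 ≤ k.im) (h1 : k ≠ 1) (h2 : k ≠ -1) :
    ellipticKappa k ≠ 0 := by
  intro h
  have h3 := norm_mul_norm_ellipticE_le hk
  rw [h, norm_zero, mul_zero] at h3
  have h4 : ellipticE k ≠ 0 := fun h => by simpa [h] using ellipticE_re_pos hk
  have := mul_pos (norm_pos_iff.2 (one_sub_sq_ne_zero h1 h2)) (norm_pos_iff.2 h4)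
  linarith

theorem norm_ellipticRatio_le {k : ℂ} (hk : 0 ≤ k.im) : ‖ellipticRatio k‖ ≤ 1 + ‖k‖ ^ 2 := by
  rw [ellipticRatio, norm_div, norm_mul]
  exact div_le_of_le_mul₀ (norm_nonneg _) (by positivity) (norm_mul_norm_ellipticE_le hk)

theorem continuousWithinAt_ellipticRatio {k : ℂ} (hk : 0 ≤ k.im) (h1 : k ≠ 1) (h2 : k ≠ -1) :
    ContinuousWithinAt ellipticRatio {k | 0 ≤ k.im} k := by
  refine ContinuousWithinAt.div ?_ (continuousOn_ellipticKappa k hk) (ellipticKappa_ne_zero hk h1 h2)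
  exact ContinuousWithinAt.mul (by fun_prop) (continuousOn_ellipticE k hk)

theorem ellipticRatio_eq {k : ℂ} (hk : k ∈ slitDomain) :
    ellipticRatio k = ellipticE k / ellipticK k := by
  have h : 1 - k ^ 2 ≠ 0 := by
    refine one_sub_sq_ne_zero ?_ ?_ <;> rintro rfl <;> rcases hk with hk | hk <;> simp at hk
  rw [ellipticRatio, ellipticKappa_eq hk, mul_div_mul_left _ _ h]

theorem differentiableAt_ellipticRatio {k : ℂ} (hk : 0 < k.im) :
    DifferentiableAt ℂ ellipticRatio k := by
  have hn : slitDomain ∈ 𝓝 k := isOpen_slitDomain.mem_nhds (Or.inl hk)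
  have h := (differentiableOn_ellipticE.differentiableAt hn).div
    (differentiableOn_ellipticK.differentiableAt hn) (ellipticK_ne_zero hk)
  refine h.congr_of_eventuallyEq ?_
  filter_upwards [hn] with x hx using ellipticRatio_eq hx

theorem mul_ellipticRatio_ofReal_im_neg {t : ℝ} (ht : 1 < |t|) :
    t * (ellipticRatio t).im < 0 := by
  have h0 : 0 ≤ (t : ℂ).im := by simp
  have ht1 : (t : ℂ) ≠ 1 := by
    intro h; rw [ofReal_eq_one.1 h] at ht; norm_num at ht
  have ht2 : (t : ℂ) ≠ -1 := by
    intro h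
    have : t = -1 := by exact_mod_cast h
    rw [this] at ht; norm_num at ht
  have hκ := ellipticKappa_ne_zero h0 ht1 ht2
  have h := neg_re_mul_im_kappa_ge h0
  have h1 := mul_ellipticE_ofReal_im_neg ht
  have h2 := ellipticE_re_pos h0
  have h3 := norm_pos_iff.2 (one_sub_sq_ne_zero ht1 ht2)
  rw [ofReal_re] at h
  have h4 : 0 < 2 * (ellipticE t).re * (-(t * (ellipticE t).im)) * ‖1 - (t : ℂ) ^ 2‖ ^ 2 := by
    have := neg_pos.2 h1
    positivity
  have h5 := pos_of_mul_pos_right (h4.trans_le h) (by positivity)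
  have h6 : ellipticRatio t = ((1 - (t : ℂ) ^ 2) * ellipticE t *
      (starRingEnd ℂ) (ellipticKappa t)) * ((normSq (ellipticKappa t))⁻¹ : ℝ) := by
    rw [ellipticRatio, div_eq_mul_inv, inv_def, mul_assoc]
    simp only [mul_assoc]
  rw [h6, im_mul_ofReal, ← mul_assoc]
  exact mul_neg_of_neg_of_pos (neg_pos.1 h5) (inv_pos.2 (normSq_pos.2 hκ))

/-! ### A vanishing theorem for holomorphic functions on the upper half plane -/

theorem integral_im_ofReal_le {g : ℂ → ℂ} (hc : ContinuousOn g {z | 0 ≤ z.im})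
    (hd : DifferentiableOn ℂ g {z | 0 < z.im}) {C : ℝ}
    (hC : ∀ z : ℂ, 0 ≤ z.im → 2 ≤ ‖z‖ → ‖g z‖ ≤ C / ‖z‖ ^ 2) {R : ℝ} (hR : 2 ≤ R) :
    ∫ t in (-R)..R, (g t).im ≤ 4 * C / R := by
  have hR0 : 0 < R := by linarith
  have hC0 : 0 ≤ C := by
    have h := (norm_nonneg _).trans (hC (2 * I) (by simp) (by simp))
    by_contra hneg
    have : C / ‖(2 * I : ℂ)‖ ^ 2 < 0 := div_neg_of_neg_of_pos (not_le.1 hneg) (by simp)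
    linarith
  have hbound : ∀ z : ℂ, 0 ≤ z.im → R ≤ ‖z‖ → ‖g z‖ ≤ C / R ^ 2 := fun z hz hRz =>
    (hC z hz (hR.trans hRz)).trans (by gcongr)
  have hrect := integral_boundary_rect_eq_zero_of_continuousOn_of_differentiableOn g
    (-R : ℂ) (R + R * I : ℂ)
    (hc.mono fun z hz => by
      have h2 := hz.2
      simp [uIcc_of_le hR0.le] at h2
      exact h2.1)
    (hd.mono fun z hz => by
      have h2 := hz.2
      simp [hR0.le] at h2
      exact h2.1)
  simp only [neg_re, ofReal_re, add_re, mul_re, I_re, mul_zero, ofReal_im, I_im, mul_one, sub_self,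
    add_zero, neg_im, neg_zero, ofReal_zero, zero_mul, add_im, mul_im, zero_add, smul_eq_mul]
    at hrect
  have b1 : ‖∫ x in (-R)..R, g (x + R * I)‖ ≤ C / R ^ 2 * |R - -R| :=
    intervalIntegral.norm_integral_le_of_norm_le_const fun x _ =>
      hbound _ (by simpa using hR0.le) (by
        simpa [abs_of_pos hR0] using abs_im_le_norm (x + R * I : ℂ))
  have b2 : ‖∫ y in (0 : ℝ)..R, g (R + y * I)‖ ≤ C / R ^ 2 * |R - 0| :=
    intervalIntegral.norm_integral_le_of_norm_le_const fun y hy =>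
      hbound _ (by rw [uIoc_of_le hR0.le] at hy; simpa using hy.1.le) (by
        simpa [abs_of_pos hR0] using abs_re_le_norm (R + y * I : ℂ))
  have b3 : ‖∫ y in (0 : ℝ)..R, g (-R + y * I)‖ ≤ C / R ^ 2 * |R - 0| :=
    intervalIntegral.norm_integral_le_of_norm_le_const fun y hy =>
      hbound _ (by rw [uIoc_of_le hR0.le] at hy; simpa using hy.1.le) (by
        simpa [abs_of_pos hR0] using abs_re_le_norm (-R + y * I : ℂ))
  have hprimitive : IntervalIntegrable (fun t : ℝ => g t) volume (-R) R :=
    (hc.comp (f := fun t : ℝ => (t : ℂ)) (by fun_prop) fun t _ => by simp).intervalIntegrable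
  have him : ∫ t in (-R)..R, (g t).im = (∫ t in (-R)..R, g t).im :=
    imCLM.intervalIntegral_comp_comm hprimitive
  push_cast at hrect
  have heq : ∫ t in (-R)..R, g t = (∫ x in (-R)..R, g (x + R * I)) -
      I * (∫ y in (0 : ℝ)..R, g (R + y * I)) + I * ∫ y in (0 : ℝ)..R, g (-R + y * I) := by
    linear_combination hrect
  rw [him]
  refine (le_abs_self _).trans ((abs_im_le_norm _).trans ?_)
  rw [heq]
  refine (norm_add_le _ _).trans ((add_le_add_left (norm_sub_le _ _) _).trans ?_)
  rw [norm_mul, norm_mul, norm_I, one_mul, one_mul]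
  refine (add_le_add (add_le_add b1 b2) b3).trans_eq ?_
  rw [sub_zero, abs_of_pos hR0, sub_neg_eq_add, abs_of_pos (by linarith)]
  field_simp
  ring

theorem not_im_pos_of_norm_le {g : ℂ → ℂ} (hc : ContinuousOn g {z | 0 ≤ z.im})
    (hd : DifferentiableOn ℂ g {z | 0 < z.im}) {C : ℝ}
    (hC : ∀ z : ℂ, 0 ≤ z.im → 2 ≤ ‖z‖ → ‖g z‖ ≤ C / ‖z‖ ^ 2)
    (hpos : ∀ t : ℝ, 0 ≤ (g t).im) (t : ℝ) : ¬ 0 < (g t).im := by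
  intro ht
  have hcr : Continuous fun t : ℝ => (g t).im := continuous_im.comp
    (hc.comp_continuous continuous_ofReal fun t => by simp)
  set R₀ := |t| + 2 with hR₀
  have h0 : 0 < ∫ t in (-R₀)..R₀, (g t).im :=
    intervalIntegral.integral_pos (by linarith [abs_nonneg t]) hcr.continuousOn
      (fun x _ => hpos x) ⟨t, ⟨by linarith [neg_abs_le t], by linarith [le_abs_self t]⟩, ht⟩
  set J := ∫ t in (-R₀)..R₀, (g t).im with hJ
  set R := max R₀ (4 * C / J + 1) with hR
  have hR1 : R₀ ≤ R := le_max_left _ _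
  have hR2 : 2 ≤ R := by linarith [abs_nonneg t]
  have h1 := integral_im_ofReal_le hc hd hC hR2
  have h2 : J ≤ ∫ t in (-R)..R, (g t).im :=
    intervalIntegral.integral_mono_interval (by linarith) (by linarith [abs_nonneg t]) hR1
      (ae_of_all _ hpos) (hcr.intervalIntegrable _ _)
  have h3 : J ≤ 4 * C / R := h2.trans h1
  rw [le_div_iff₀ (by linarith)] at h3
  have h4 : 4 * C / J + 1 ≤ R := le_max_right _ _
  have h5 := mul_le_mul_of_nonneg_left h4 h0.le
  rw [mul_add, mul_div_cancel₀ _ h0.ne'] at h5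
  linarith

/-! ### Zeros of `P K + Q E` -/

theorem aeval_ofReal_eq (P : ℝ[X]) (t : ℝ) : aeval (t : ℂ) P = (P.eval t : ℝ) := by
  simpa using aeval_algebraMap_apply_eq_algebraMap_eval (A := ℂ) t P

theorem Kc_pos {k : ℝ} (hk : k ∈ Ioo (-1 : ℝ) 1) : 0 < Kc k := by
  have h := fun θ => Real.sqrt_pos.2 (one_sub_sq_mul_sin_sq_pos hk θ)
  rw [Kc_eq_integral]
  exact intervalIntegral.intervalIntegral_pos_of_pos
    (((continuous_const.div (continuous_sqrt_one_sub k) fun θ => (h θ).ne')).intervalIntegrable _ _)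
    (fun θ => one_div_pos.2 (h θ)) (by positivity)

theorem analyticOrderAt_eval {P : ℝ[X]} (hP : P ≠ 0) (x : ℝ) :
    analyticOrderAt (fun k => P.eval k) x = P.rootMultiplicity x := by
  obtain ⟨q, hq, hdvd⟩ := P.exists_eq_pow_rootMultiplicity_mul_and_not_dvd hP x
  rw [(AnalyticOnNhd.eval_polynomial P x (mem_univ x)).analyticOrderAt_eq_natCast]
  refine ⟨fun k => q.eval k, AnalyticOnNhd.eval_polynomial q x (mem_univ x),
    fun h => hdvd (dvd_iff_isRoot.2 h), Eventually.of_forall fun z => ?_⟩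
  conv_lhs => rw [hq]
  simp

theorem sum_analyticOrderNatAt_eval_le (P : ℝ[X]) (T : Finset ℝ) :
    ∑ x ∈ T, analyticOrderNatAt (fun k => P.eval k) x ≤ P.natDegree := by
  rcases eq_or_ne P 0 with rfl | hP
  · refine (Finset.sum_eq_zero fun x _ => ?_).le
    have : analyticOrderAt (fun k => (0 : ℝ[X]).eval k) x = ⊤ := by simp [analyticOrderAt_eq_top]
    rw [analyticOrderNatAt, this]; rfl
  · calc ∑ x ∈ T, analyticOrderNatAt (fun k => P.eval k) x
        = ∑ x ∈ T, P.roots.count x := Finset.sum_congr rfl fun x _ => by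
          rw [analyticOrderNatAt, analyticOrderAt_eval hP, ENat.toNat_natCast, count_roots]
      _ ≤ ∑ x ∈ P.roots.toFinset, P.roots.count x := Finset.sum_le_sum_of_ne_zero fun x _ h => by
          exact Multiset.mem_toFinset.2 (Multiset.count_ne_zero.1 h)
      _ = Multiset.card P.roots := Multiset.toFinset_sum_count_eq _
      _ ≤ P.natDegree := P.card_roots'

theorem natCast_le_analyticOrderAt_ofReal {F : ℝ → ℝ} {G : ℂ → ℂ} {x : ℝ} {n : ℕ}
    (hF : AnalyticAt ℝ F x) (hG : AnalyticAt ℂ G x) (h : ∀ᶠ t : ℝ in 𝓝 x, G (t : ℂ) = (F t : ℂ))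
    (hn : n ≤ analyticOrderAt F x) : n ≤ analyticOrderAt G x := by
  by_contra hlt
  rw [not_le] at hlt
  obtain ⟨N, hN⟩ := ENat.ne_top_iff_exists.1 (ne_top_of_lt hlt)
  rw [← hN, Nat.cast_lt] at hlt
  obtain ⟨g, hg, hg0, hgeq⟩ := hG.analyticOrderAt_eq_natCast.1 hN.symm
  obtain ⟨f, hf, hfeq⟩ := (natCast_le_analyticOrderAt hF).1 hn
  have ht : Tendsto (fun t : ℝ => (t : ℂ)) (𝓝 x) (𝓝 (x : ℂ)) := continuous_ofReal.tendsto x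
  have h1 : Tendsto (fun t : ℝ => g t) (𝓝[≠] x) (𝓝 (g x)) :=
    (hg.continuousAt.tendsto.comp ht).mono_left nhdsWithin_le_nhds
  have h2 : Tendsto (fun t : ℝ => (((t - x) ^ (n - N) * f t : ℝ) : ℂ)) (𝓝[≠] x) (𝓝 0) := by
    have h3 : ContinuousAt (fun t : ℝ => (((t - x) ^ (n - N) * f t : ℝ) : ℂ)) x :=
      continuous_ofReal.continuousAt.comp (ContinuousAt.mul (by fun_prop) hf.continuousAt)
    have h4 := h3.tendsto.mono_left (nhdsWithin_le_nhds (s := {x}ᶜ))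
    simpa [zero_pow (Nat.sub_ne_zero_of_lt hlt)] using h4
  refine hg0 (tendsto_nhds_unique h1 (h2.congr' ?_))
  filter_upwards [self_mem_nhdsWithin, nhdsWithin_le_nhds h, nhdsWithin_le_nhds (ht.eventually hgeq),
    nhdsWithin_le_nhds hfeq] with t ht1 ht2 ht3 ht4
  have h5 : ((t : ℂ) - x) ≠ 0 := by
    rw [← ofReal_sub, ofReal_ne_zero]; exact sub_ne_zero.2 ht1
  rw [ht2, ht4, smul_eq_mul, smul_eq_mul] at ht3
  have h6 : n = N + (n - N) := by omega
  rw [h6, pow_add, mul_assoc] at ht3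
  push_cast at ht3 ⊢
  exact mul_left_cancel₀ (pow_ne_zero N h5) ht3

theorem exists_norm_aeval_le {P : ℝ[X]} {d : ℕ} (hP : P.natDegree ≤ d) :
    ∃ C, 0 ≤ C ∧ ∀ z : ℂ, 1 ≤ ‖z‖ → ‖aeval z P‖ ≤ C * ‖z‖ ^ d := by
  refine ⟨∑ i ∈ Finset.range (P.natDegree + 1), ‖P.coeff i‖, by positivity, fun z hz => ?_⟩
  rw [aeval_eq_sum_range, Finset.sum_mul]
  refine (norm_sum_le _ _).trans (Finset.sum_le_sum fun i hi => ?_)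
  rw [norm_smul, norm_pow]
  gcongr
  rw [Finset.mem_range] at hi; omega

/-- `(1 - z²) E(z) / K(z)`, which extends continuously to the closed upper half plane. -/
noncomputable def scaledRatio (z : ℂ) : ℂ := (1 - z ^ 2) * ellipticRatio z

theorem norm_scaledRatio_le {z : ℂ} (hz : 0 ≤ z.im) :
    ‖scaledRatio z‖ ≤ ‖1 - z ^ 2‖ * (1 + ‖z‖ ^ 2) := by
  rw [scaledRatio, norm_mul]
  exact mul_le_mul_of_nonneg_left (norm_ellipticRatio_le hz) (norm_nonneg _)

theorem continuousOn_scaledRatio : ContinuousOn scaledRatio {z | 0 ≤ z.im} := by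
  intro z hz
  by_cases h : 1 - z ^ 2 = 0
  · have h0 : scaledRatio z = 0 := by rw [scaledRatio, h, zero_mul]
    rw [ContinuousWithinAt, h0]
    refine squeeze_zero_norm' (a := fun z => ‖1 - z ^ 2‖ * (1 + ‖z‖ ^ 2))
      (by filter_upwards [self_mem_nhdsWithin] with z hz using norm_scaledRatio_le hz) ?_
    have hc : Continuous fun z : ℂ => ‖1 - z ^ 2‖ * (1 + ‖z‖ ^ 2) := by fun_prop
    have := (hc.tendsto z).mono_left (nhdsWithin_le_nhds (s := {z | 0 ≤ z.im}))
    rwa [h, norm_zero, zero_mul] at this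
  · refine ContinuousWithinAt.mul (by fun_prop) (continuousWithinAt_ellipticRatio hz ?_ ?_) <;>
      rintro rfl <;> simp at h

/-- The quotient of `Q (1 - z²) (P + Q E / K)` by a polynomial with prescribed zeros, times a power
of `z`. -/
noncomputable def zeroQuotient (P Q : ℝ[X]) (T : Finset ℝ) (n : ℝ → ℕ) (ε : ℕ) (z : ℂ) : ℂ :=
  z ^ ε * (aeval z Q * ((1 - z ^ 2) * aeval z P + aeval z Q * scaledRatio z)) /
    ∏ x ∈ T, (z - x) ^ n x

theorem prod_sub_pow_ne_zero {T : Finset ℝ} {n : ℝ → ℕ} {z : ℂ} (hz : ∀ x ∈ T, z ≠ x) :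
    ∏ x ∈ T, (z - x) ^ n x ≠ 0 :=
  Finset.prod_ne_zero_iff.2 fun x hx => pow_ne_zero _ (sub_ne_zero.2 (hz x hx))

theorem ne_ofReal_of_im_pos {z : ℂ} (hz : 0 < z.im) (x : ℝ) : z ≠ x := by
  rintro rfl; simp at hz

theorem continuousWithinAt_zeroQuotient {P Q : ℝ[X]} {T : Finset ℝ} {n : ℝ → ℕ} {ε : ℕ} {z : ℂ}
    (hz : 0 ≤ z.im) (hzT : ∀ x ∈ T, z ≠ x) :
    ContinuousWithinAt (zeroQuotient P Q T n ε) {z | 0 ≤ z.im} z := by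
  have h1 := continuousOn_scaledRatio z hz
  have h2 := P.continuous_aeval (A := ℂ)
  have h3 := Q.continuous_aeval (A := ℂ)
  refine ContinuousWithinAt.div ?_
    (continuous_finsetProd _ fun x _ => by fun_prop).continuousWithinAt (prod_sub_pow_ne_zero hzT)
  refine ContinuousWithinAt.mul (by fun_prop) (ContinuousWithinAt.mul (by fun_prop) ?_)
  exact ContinuousWithinAt.add (by fun_prop) (ContinuousWithinAt.mul (by fun_prop) h1)

theorem differentiableOn_zeroQuotient (P Q : ℝ[X]) (T : Finset ℝ) (n : ℝ → ℕ) (ε : ℕ) :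
    DifferentiableOn ℂ (zeroQuotient P Q T n ε) {z | 0 < z.im} := by
  intro z hz
  refine DifferentiableAt.differentiableWithinAt ?_
  have h1 := differentiableAt_ellipticRatio hz
  have h2 := P.differentiableAt_aeval (x := z)
  have h3 := Q.differentiableAt_aeval (x := z)
  refine DifferentiableAt.div ?_ ?_ (prod_sub_pow_ne_zero fun x _ => ne_ofReal_of_im_pos hz x)
  · unfold scaledRatio
    fun_prop
  · fun_prop

theorem exists_norm_zeroQuotient_le {P Q : ℝ[X]} {d : ℕ} (hP : P.natDegree ≤ d)
    (hQ : Q.natDegree ≤ d) {T : Finset ℝ} (hT : ∀ x ∈ T, x ∈ Ioo (-1 : ℝ) 1) {n : ℝ → ℕ} {ε : ℕ}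
    (hN : 2 * d + 6 + ε ≤ ∑ x ∈ T, n x) :
    ∃ C, ∀ z : ℂ, 0 ≤ z.im → 2 ≤ ‖z‖ → ‖zeroQuotient P Q T n ε z‖ ≤ C / ‖z‖ ^ 2 := by
  obtain ⟨CP, hCP, hP'⟩ := exists_norm_aeval_le hP
  obtain ⟨CQ, hCQ, hQ'⟩ := exists_norm_aeval_le hQ
  set N := ∑ x ∈ T, n x with hNdef
  refine ⟨CQ * (4 * (CP + CQ)) * 2 ^ N, fun z hz h2 => ?_⟩
  have h1 : 1 ≤ ‖z‖ := by linarith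
  have hp := hP' z h1
  have hq := hQ' z h1
  have hsq : 1 ≤ ‖z‖ ^ 2 := one_le_pow₀ h1
  have hone : ‖1 - z ^ 2‖ ≤ 2 * ‖z‖ ^ 2 := by
    refine (norm_sub_le _ _).trans ?_
    rw [norm_one, norm_pow]; linarith
  have hone' : ‖1 - z ^ 2‖ ≤ 4 * ‖z‖ ^ 4 := by
    nlinarith
  have hb : ‖scaledRatio z‖ ≤ 4 * ‖z‖ ^ 4 := by
    refine (norm_scaledRatio_le hz).trans ?_
    calc ‖1 - z ^ 2‖ * (1 + ‖z‖ ^ 2) ≤ (2 * ‖z‖ ^ 2) * (2 * ‖z‖ ^ 2) := by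
          gcongr; linarith
      _ = 4 * ‖z‖ ^ 4 := by ring
  have hprod : (‖z‖ / 2) ^ N ≤ ‖∏ x ∈ T, (z - x) ^ n x‖ := by
    rw [norm_prod, hNdef, ← Finset.prod_pow_eq_pow_sum]
    refine Finset.prod_le_prod (fun _ _ => by positivity) fun x hx => ?_
    rw [norm_pow]
    gcongr
    have h3 : ‖(x : ℂ)‖ ≤ 1 := by
      rw [norm_real]; exact (abs_lt.2 (hT x hx)).le
    linarith [norm_sub_norm_le z (x : ℂ)]
  rw [zeroQuotient, norm_div, norm_mul, norm_mul, norm_pow]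
  have hz0 : 0 < ‖z‖ := by linarith
  have hnum : ‖z‖ ^ ε * (‖aeval z Q‖ * ‖(1 - z ^ 2) * aeval z P + aeval z Q * scaledRatio z‖) ≤
      ‖z‖ ^ ε * ((CQ * ‖z‖ ^ d) * ((4 * ‖z‖ ^ 4) * (CP * ‖z‖ ^ d) +
        (CQ * ‖z‖ ^ d) * (4 * ‖z‖ ^ 4))) := by
    gcongr
    refine (norm_add_le _ _).trans ?_
    rw [norm_mul, norm_mul]
    gcongr
  rw [div_le_div_iff₀ (lt_of_lt_of_le (by positivity) hprod) (by positivity)]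
  calc _ ≤ (‖z‖ ^ ε * ((CQ * ‖z‖ ^ d) * ((4 * ‖z‖ ^ 4) * (CP * ‖z‖ ^ d) +
        (CQ * ‖z‖ ^ d) * (4 * ‖z‖ ^ 4)))) * ‖z‖ ^ 2 := by gcongr
    _ = CQ * (4 * (CP + CQ)) * ‖z‖ ^ (2 * d + 6 + ε) := by ring
    _ ≤ CQ * (4 * (CP + CQ)) * ‖z‖ ^ N := by gcongr
    _ = CQ * (4 * (CP + CQ)) * 2 ^ N * (‖z‖ / 2) ^ N := by
        rw [mul_assoc _ (2 ^ N), ← mul_pow, mul_div_cancel₀ _ two_ne_zero]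
    _ ≤ _ := by gcongr

theorem exists_tendsto_zeroQuotient {P Q : ℝ[X]} {T : Finset ℝ} {n : ℝ → ℕ} (ε : ℕ) {x : ℝ}
    (hxT : x ∈ T) (hx : x ∈ Ioo (-1 : ℝ) 1)
    (hn : n x ≤ analyticOrderAt (fun k => P.eval k * Kc k + Q.eval k * Ec k) x) :
    ∃ y, Tendsto (zeroQuotient P Q T n ε) (𝓝[{z | 0 < z.im}] (x : ℂ)) (𝓝 y) := by
  have hmem : slitDomain ∈ 𝓝 (x : ℂ) := isOpen_slitDomain.mem_nhds (ofReal_mem_slitDomain hx)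
  have hE := differentiableOn_ellipticE.analyticAt hmem
  have hK := differentiableOn_ellipticK.analyticAt hmem
  have hpoly (R : ℝ[X]) : AnalyticAt ℂ (fun z : ℂ => aeval z R) x :=
    (R.differentiable_aeval (𝕜 := ℂ)).analyticAt _
  have hG : AnalyticAt ℂ (fun z => aeval z P * ellipticK z + aeval z Q * ellipticE z) x :=
    ((hpoly P).mul hK).add ((hpoly Q).mul hE)
  have hFR (R : ℝ[X]) : AnalyticAt ℝ (fun k => R.eval k) x :=
    AnalyticOnNhd.eval_polynomial R x (mem_univ x)
  have hn' := natCast_le_analyticOrderAt_ofReal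
    (((hFR P).mul (analyticAt_Kc hx)).add ((hFR Q).mul (analyticAt_Ec hx))) hG (by
      filter_upwards [isOpen_Ioo.mem_nhds hx] with t ht
      simp only [Pi.add_apply, Pi.mul_apply]
      rw [ellipticK_ofReal ht, ellipticE_ofReal ht, aeval_ofReal_eq, aeval_ofReal_eq]
      push_cast
      rfl) hn
  obtain ⟨G, hGan, hGeq⟩ := (natCast_le_analyticOrderAt hG).1 hn'
  have hK0 : ellipticK x ≠ 0 := by
    rw [ellipticK_ofReal hx, ofReal_ne_zero]; exact (Kc_pos hx).ne'
  have hprod : ∏ y ∈ T.erase x, ((x : ℂ) - y) ^ n y ≠ 0 :=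
    prod_sub_pow_ne_zero fun y hy => by
      rw [Ne, ofReal_inj]; exact (Finset.ne_of_mem_erase hy).symm
  have hcont : ContinuousAt (fun z : ℂ => z ^ ε * (aeval z Q * ((1 - z ^ 2) * (G z / ellipticK z))) /
      ∏ y ∈ T.erase x, (z - y) ^ n y) x := by
    refine ContinuousAt.div ?_ (continuous_finsetProd _ fun y _ => by fun_prop).continuousAt hprod
    have h1 := (hpoly Q).continuousAt
    have h2 := hGan.continuousAt.div hK.continuousAt hK0
    exact ContinuousAt.mul (by fun_prop) (h1.mul (ContinuousAt.mul (by fun_prop) h2))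
  refine ⟨_, (hcont.tendsto.mono_left nhdsWithin_le_nhds).congr' ?_⟩
  filter_upwards [self_mem_nhdsWithin, nhdsWithin_le_nhds hGeq, nhdsWithin_le_nhds hmem]
    with z hz hz2 hz3
  have hKz := ellipticK_ne_zero hz
  have hzx : (z - x) ^ n x ≠ 0 := pow_ne_zero _ (sub_ne_zero.2 (ne_ofReal_of_im_pos hz x))
  have h3 : (1 - z ^ 2) * aeval z P + aeval z Q * scaledRatio z =
      (z - x) ^ n x * ((1 - z ^ 2) * (G z / ellipticK z)) := by
    rw [smul_eq_mul] at hz2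
    rw [scaledRatio, ellipticRatio_eq hz3]
    field_simp
    linear_combination (1 - z ^ 2) * hz2
  rw [zeroQuotient, h3, ← Finset.mul_prod_erase T _ hxT,
    show z ^ ε * (aeval z Q * ((z - x) ^ n x * ((1 - z ^ 2) * (G z / ellipticK z)))) =
      (z - x) ^ n x * (z ^ ε * (aeval z Q * ((1 - z ^ 2) * (G z / ellipticK z)))) by ring,
    mul_div_mul_left _ _ hzx]

theorem zeroQuotient_ofReal_im (P Q : ℝ[X]) (T : Finset ℝ) (n : ℝ → ℕ) (ε : ℕ) (t : ℝ) :
    (zeroQuotient P Q T n ε t).im =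
      t ^ ε * Q.eval t ^ 2 * (1 - t ^ 2) * (ellipticRatio t).im / ∏ x ∈ T, (t - x) ^ n x := by
  have h : zeroQuotient P Q T n ε t =
      ((t ^ ε * (Q.eval t * ((1 - t ^ 2) * P.eval t)) / ∏ x ∈ T, (t - x) ^ n x : ℝ) : ℂ) +
      ((t ^ ε * Q.eval t ^ 2 * (1 - t ^ 2) / ∏ x ∈ T, (t - x) ^ n x : ℝ) : ℂ) *
        ellipticRatio t := by
    rw [zeroQuotient, scaledRatio, aeval_ofReal_eq, aeval_ofReal_eq]
    push_cast
    ring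
  rw [h, add_im, ofReal_im, im_ofReal_mul]
  ring

theorem prod_sub_pow_pos {T : Finset ℝ} (hT : ∀ x ∈ T, x ∈ Ioo (-1 : ℝ) 1) {n : ℝ → ℕ} {ε : ℕ}
    (hodd : Odd (∑ x ∈ T, n x + ε)) {t : ℝ} (ht : 1 < |t|) :
    0 < t ^ (ε + 1) * ∏ x ∈ T, (t - x) ^ n x := by
  rcases lt_abs.1 ht with h | h
  · exact mul_pos (by positivity)
      (Finset.prod_pos fun x hx => pow_pos (by linarith [(hT x hx).2]) _)
  · have h1 : ∏ x ∈ T, (t - x) ^ n x = (-1) ^ (∑ x ∈ T, n x) * ∏ x ∈ T, (x - t) ^ n x := by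
      rw [← Finset.prod_pow_eq_pow_sum, ← Finset.prod_mul_distrib]
      refine Finset.prod_congr rfl fun x _ => ?_
      rw [← mul_pow]; ring
    have h2 : t ^ (ε + 1) = (-1) ^ (ε + 1) * (-t) ^ (ε + 1) := by rw [← mul_pow]; ring
    have h3 : ((-1 : ℝ)) ^ (ε + 1) * (-1) ^ (∑ x ∈ T, n x) = 1 := by
      rw [← pow_add]
      exact Even.neg_one_pow (by rw [show ε + 1 + ∑ x ∈ T, n x = (∑ x ∈ T, n x + ε) + 1 by ring]
                                 exact hodd.add_one)
    rw [h1, h2, show ((-1 : ℝ)) ^ (ε + 1) * (-t) ^ (ε + 1) *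
      ((-1) ^ (∑ x ∈ T, n x) * ∏ x ∈ T, (x - t) ^ n x) =
      ((-1 : ℝ)) ^ (ε + 1) * (-1) ^ (∑ x ∈ T, n x) * ((-t) ^ (ε + 1) * ∏ x ∈ T, (x - t) ^ n x) by ring,
      h3, one_mul]
    exact mul_pos (pow_pos (by linarith) _)
      (Finset.prod_pos fun x hx => pow_pos (by linarith [(hT x hx).1]) _)

theorem zeroQuotient_ofReal_im_pos {P Q : ℝ[X]} {T : Finset ℝ} (hT : ∀ x ∈ T, x ∈ Ioo (-1 : ℝ) 1)
    {n : ℝ → ℕ} {ε : ℕ} (hodd : Odd (∑ x ∈ T, n x + ε)) {t : ℝ} (ht : 1 < |t|)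
    (hQ : Q.eval t ≠ 0) : 0 < (zeroQuotient P Q T n ε t).im := by
  have h1 := prod_sub_pow_pos hT hodd ht
  have h2 := mul_ellipticRatio_ofReal_im_neg ht
  have ht2 : 1 < t ^ 2 := by rw [← sq_abs]; nlinarith
  have h5 : 0 < Q.eval t ^ 2 := by positivity
  rw [zeroQuotient_ofReal_im]
  generalize ∏ x ∈ T, (t - x) ^ n x = Z at h1 ⊢
  have h3 : Z ≠ 0 := fun h => by rw [h, mul_zero] at h1; exact h1.false
  have ht0 : t ≠ 0 := by rintro rfl; norm_num at ht2
  refine pos_of_mul_pos_left (b := t ^ 2 * Z ^ 2) ?_ (by positivity)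
  have h6 : t ^ ε * Q.eval t ^ 2 * (1 - t ^ 2) * (ellipticRatio t).im / Z * (t ^ 2 * Z ^ 2) =
      Q.eval t ^ 2 * (t ^ 2 - 1) * -(t * (ellipticRatio t).im) * (t ^ (ε + 1) * Z) := by
    field_simp
    ring
  rw [h6]
  exact mul_pos (mul_pos (mul_pos h5 (by linarith)) (by linarith)) h1

theorem zeroQuotient_ofReal_im_nonneg {P Q : ℝ[X]} {T : Finset ℝ}
    (hT : ∀ x ∈ T, x ∈ Ioo (-1 : ℝ) 1) {n : ℝ → ℕ} {ε : ℕ} (hodd : Odd (∑ x ∈ T, n x + ε)) (t : ℝ) :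
    0 ≤ (zeroQuotient P Q T n ε t).im := by
  by_cases ht : 1 < |t|
  · by_cases hQ : Q.eval t = 0
    · rw [zeroQuotient_ofReal_im, hQ]; simp
    · exact (zeroQuotient_ofReal_im_pos hT hodd ht hQ).le
  · rw [zeroQuotient_ofReal_im]
    rcases (not_lt.1 ht).lt_or_eq with h | h
    · have h1 : t ∈ Ioo (-1 : ℝ) 1 := abs_lt.1 h
      rw [ellipticRatio_eq (ofReal_mem_slitDomain h1), ellipticE_ofReal h1, ellipticK_ofReal h1,
        ← ofReal_div, ofReal_im]
      simp
    · rw [← sq_abs t, h]; simp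

theorem sum_analyticOrderNatAt_eval_mul_Kc_add_eval_mul_Ec_le {P Q : ℝ[X]} {d : ℕ}
    (hP : P.natDegree ≤ d) (hQ : Q.natDegree ≤ d) {T : Finset ℝ}
    (hT : ∀ x ∈ T, x ∈ Ioo (-1 : ℝ) 1) :
    ∑ x ∈ T, analyticOrderNatAt (fun k => P.eval k * Kc k + Q.eval k * Ec k) x ≤ 2 * d + 6 := by
  rcases eq_or_ne Q 0 with rfl | hQ0
  · refine le_trans ((Finset.sum_congr rfl fun x hx => ?_).trans_le
      (sum_analyticOrderNatAt_eval_le P T)) (by omega)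
    have hPx : AnalyticAt ℝ (fun k => P.eval k) x :=
      AnalyticOnNhd.eval_polynomial P x (mem_univ x)
    have hK := analyticAt_Kc (hT x hx)
    have h1 : (fun k => P.eval k * Kc k + (0 : ℝ[X]).eval k * Ec k) = (fun k => P.eval k) * Kc := by
      ext k; simp
    rw [analyticOrderNatAt, h1, analyticOrderAt_mul hPx hK,
      hK.analyticOrderAt_eq_zero.2 (Kc_pos (hT x hx)).ne', add_zero, analyticOrderNatAt]
  by_contra! hlt
  set n : ℝ → ℕ := analyticOrderNatAt (fun k => P.eval k * Kc k + Q.eval k * Ec k) with hn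
  obtain ⟨ε, hε, hodd⟩ : ∃ ε ≤ 1, Odd (∑ x ∈ T, n x + ε) := by
    rcases Nat.even_or_odd (∑ x ∈ T, n x) with h | h
    · exact ⟨1, le_rfl, h.add_one⟩
    · exact ⟨0, zero_le_one, h⟩
  set f := zeroQuotient P Q T n ε with hf
  have hclosure : closure {z : ℂ | 0 < z.im} = {z | 0 ≤ z.im} := closure_setOfPred_lt_im 0
  have hlim : ∀ z ∈ {z : ℂ | 0 ≤ z.im}, ∃ y, Tendsto f (𝓝[{z | 0 < z.im}] z) (𝓝 y) := by
    intro z hz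
    by_cases h : ∀ x ∈ T, z ≠ x
    · exact ⟨_, ((continuousWithinAt_zeroQuotient hz h).mono fun z (hz : 0 < z.im) => hz.le).tendsto⟩
    · push Not at h
      obtain ⟨x, hx, rfl⟩ := h
      exact exists_tendsto_zeroQuotient ε hx (hT x hx) (ENat.natCast_toNat_le_self _)
  have hcont := continuousOn_extendFrom hclosure.ge hlim
  have heq : ∀ z : ℂ, 0 ≤ z.im → (∀ x ∈ T, z ≠ x) → extendFrom {z | 0 < z.im} f z = f z :=
    fun z hz h => extendFrom_eq (hclosure.ge hz)
      ((continuousWithinAt_zeroQuotient hz h).mono fun z (hz : 0 < z.im) => hz.le).tendsto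
  have heqR : ∀ t : ℝ, t ∉ T → extendFrom {z | 0 < z.im} f t = f t := fun t ht =>
    heq t (by simp) fun x hx h => ht (ofReal_inj.1 h ▸ hx)
  obtain ⟨C, hC⟩ := exists_norm_zeroQuotient_le hP hQ hT (n := n) (ε := ε) (by omega)
  obtain ⟨t, ht1, htQ⟩ : ∃ t, 1 < t ∧ Q.eval t ≠ 0 := by
    obtain ⟨t, ht, htQ⟩ := (Ioi_infinite (1 : ℝ)).exists_notMem_finset Q.roots.toFinset
    exact ⟨t, ht, fun h => htQ (by simpa [hQ0] using h)⟩
  have htT : t ∉ T := fun h => by linarith [(hT t h).2]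
  refine not_im_pos_of_norm_le hcont ?_ (C := C) ?_ ?_ t ?_
  · exact (differentiableOn_zeroQuotient P Q T n ε).congr fun z hz =>
      heq z (le_of_lt hz) fun x _ => ne_ofReal_of_im_pos hz x
  · intro z hz hz2
    rw [heq z hz fun x hx h => ?_]
    · exact hC z hz hz2
    · rw [h, norm_real] at hz2
      linarith [abs_lt.2 (hT x hx), Real.norm_eq_abs x]
  · have hc : Continuous fun t : ℝ => (extendFrom {z | 0 < z.im} f t).im :=
      continuous_im.comp (hcont.comp_continuous continuous_ofReal fun t => by simp)
    intro t
    refine le_on_closure (s := ((T : Set ℝ))ᶜ) (f := fun _ => (0 : ℝ)) (fun t ht => ?_)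
      continuousOn_const hc.continuousOn ((T.countable_toSet.dense_compl ℝ).closure_eq ▸ mem_univ t)
    rw [heqR t (by simpa using ht)]
    exact zeroQuotient_ofReal_im_nonneg hT hodd t
  · rw [heqR t htT]
    exact zeroQuotient_ofReal_im_pos hT hodd (by rw [abs_of_pos] <;> linarith) htQ

/-! ### Counting zeros by the theorem of Rolle -/

theorem sum_le_of_rolle {φ V : ℝ → ℝ} {r : ℝ[X]} (hr : r ≠ 0) {S : Set ℝ} (hS : OrdConnected S)
    {a b : ℝ → ℕ} {B : ℕ}
    (hrolle : ∀ x ∈ S, ∀ y ∈ S, x < y → φ x = 0 → φ y = 0 → (∀ z ∈ Icc x y, r.eval z ≠ 0) →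
      ∃ z ∈ Ioo x y, V z = 0)
    (hab : ∀ x ∈ S, a x ≤ b x + 1) (hab' : ∀ x ∈ S, r.eval x = 0 → a x ≤ b x)
    (hb : ∀ x ∈ S, V x = 0 → 1 ≤ b x)
    (hB : ∀ T : Finset ℝ, (∀ x ∈ T, x ∈ S) → ∑ x ∈ T, b x ≤ B)
    {T : Finset ℝ} (hT : ∀ x ∈ T, x ∈ S ∧ φ x = 0) :
    ∑ x ∈ T, a x ≤ B + r.natDegree + 1 := by
  classical
  choose! c hc hVc using hrolle
  set R := r.roots.toFinset with hR
  have hmemR (x : ℝ) : x ∈ R ↔ r.eval x = 0 := by simp [hR, hr]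
  set Z := ((T ×ˢ T).image fun x => c x.1 x.2).filter fun z => z ∈ S ∧ V z = 0 with hZ
  have hcard : (T \ R).card ≤ ((Z ∪ R) \ (T \ R)).card + 1 := by
    refine Finset.card_le_sdiff_of_interleaved fun x hx y hy hxy _ => ?_
    rw [Finset.mem_sdiff] at hx hy
    by_cases h : ∀ z ∈ Icc x y, r.eval z ≠ 0
    · have h1 := hc x (hT x hx.1).1 y (hT y hy.1).1 hxy (hT x hx.1).2 (hT y hy.1).2 h
      have h2 := hVc x (hT x hx.1).1 y (hT y hy.1).1 hxy (hT x hx.1).2 (hT y hy.1).2 h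
      refine ⟨c x y, Finset.mem_union_left _ (Finset.mem_filter.2 ⟨Finset.mem_image.2
        ⟨(x, y), Finset.mem_product.2 ⟨hx.1, hy.1⟩, rfl⟩, ?_, h2⟩), h1.1, h1.2⟩
      exact hS.out (hT x hx.1).1 (hT y hy.1).1 (Ioo_subset_Icc_self h1)
    · push Not at h
      obtain ⟨z, hz, hz0⟩ := h
      have hzR := (hmemR z).2 hz0
      exact ⟨z, Finset.mem_union_right _ hzR, hz.1.lt_of_ne fun h => hx.2 (h ▸ hzR),
        hz.2.lt_of_ne fun h => hy.2 (h ▸ hzR)⟩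
  have hsub : (Z ∪ R) \ (T \ R) ⊆ ((Z \ T) \ R) ∪ R := by
    intro z hz
    simp only [Finset.mem_sdiff, Finset.mem_union] at hz ⊢
    tauto
  have hcardR : R.card ≤ r.natDegree := r.roots.toFinset_card_le.trans r.card_roots'
  have hcard2 := (Finset.card_le_card hsub).trans (Finset.card_union_le _ _)
  have hZV : ((Z \ T) \ R).card ≤ ∑ x ∈ Z \ T, b x := by
    refine (Finset.card_le_card Finset.sdiff_subset).trans ?_
    rw [Finset.card_eq_sum_ones]
    refine Finset.sum_le_sum fun x hx => ?_
    have := (Finset.mem_filter.1 (Finset.mem_sdiff.1 hx).1).2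
    exact hb x this.1 this.2
  have hsum : ∑ x ∈ T, b x + ∑ x ∈ Z \ T, b x ≤ B := by
    rw [← Finset.sum_union Finset.disjoint_sdiff]
    refine hB _ fun x hx => ?_
    rcases Finset.mem_union.1 hx with h | h
    · exact (hT x h).1
    · exact (Finset.mem_filter.1 (Finset.mem_sdiff.1 h).1).2.1
  have hmain : ∑ x ∈ T, a x ≤ ∑ x ∈ T, b x + (T \ R).card := by
    rw [Finset.card_eq_sum_ones, ← Finset.sum_inter_add_sum_sdiff T R,
      ← Finset.sum_inter_add_sum_sdiff T R b]
    have h1 : ∑ x ∈ T \ R, a x ≤ ∑ x ∈ T \ R, b x + ∑ x ∈ T \ R, 1 := by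
      rw [← Finset.sum_add_distrib]
      exact Finset.sum_le_sum fun x hx => hab x (hT x (Finset.mem_sdiff.1 hx).1).1
    have h2 : ∑ x ∈ T ∩ R, a x ≤ ∑ x ∈ T ∩ R, b x := Finset.sum_le_sum fun x hx =>
      hab' x (hT x (Finset.mem_inter.1 hx).1).1 ((hmemR x).1 (Finset.mem_inter.1 hx).2)
    omega
  omega

theorem analyticOrderAt_le_of_eq_mul_deriv_add {φ V a c : ℝ → ℝ} {x : ℝ} (hφ : AnalyticAt ℝ φ x)
    (ha : AnalyticAt ℝ a x) (hc : AnalyticAt ℝ c x)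
    (hV : V =ᶠ[𝓝 x] a * deriv φ + c * φ) :
    analyticOrderAt φ x ≤ analyticOrderAt V x + 1 ∧
      (a x = 0 → analyticOrderAt φ x ≤ analyticOrderAt V x) := by
  by_cases h0 : φ x = 0
  · have h1 : analyticOrderAt (deriv φ) x + 1 = analyticOrderAt φ x := by
      simpa [h0] using hφ.analyticOrderAt_deriv_add_one
    have h2 := le_analyticOrderAt_add (f := a * deriv φ) (g := c * φ) (z₀ := x)
    rw [← analyticOrderAt_congr hV, analyticOrderAt_mul ha hφ.deriv, analyticOrderAt_mul hc hφ] at h2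
    constructor
    · rw [← h1] at h2 ⊢
      gcongr
      refine le_trans (le_min le_add_self ?_) h2
      exact le_trans le_self_add le_add_self
    · intro hax
      refine le_trans (le_min ?_ le_add_self) h2
      rw [← h1, add_comm]
      gcongr
      exact Order.one_le_iff_pos.2 (pos_iff_ne_zero.2 fun h => ha.analyticOrderAt_eq_zero.1 h hax)
  · rw [hφ.analyticOrderAt_eq_zero.2 h0]
    simp

theorem zeroMult_eq_analyticOrderNatAt {φ : ℝ → ℝ} {x : ℝ} (hφ : AnalyticAt ℝ φ x)
    (hx : analyticOrderAt φ x ≠ ⊤) : zeroMult φ x = analyticOrderNatAt φ x := by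
  obtain ⟨N, hN⟩ := ENat.ne_top_iff_exists.1 hx
  have hiff := fun n => natCast_le_analyticOrderAt_iff_iteratedDeriv_eq_zero (n := n) hφ
  rw [analyticOrderNatAt, ← hN, ENat.toNat_natCast, zeroMult]
  simp only [← hN, Nat.cast_le] at hiff
  have hNmem : N ∈ {n : ℕ | iteratedDeriv n φ x ≠ 0} := fun h =>
    absurd ((hiff (N + 1)).2 fun i hi => (Nat.lt_succ_iff_lt_or_eq.1 hi).elim
      ((hiff N).1 le_rfl i) fun h' => h' ▸ h) (by omega)
  refine le_antisymm (Nat.sInf_le hNmem) (le_csInf ⟨N, hNmem⟩ fun n hn => ?_)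
  by_contra! hlt
  exact hn ((hiff N).1 le_rfl n hlt)

theorem analyticOrderAt_ne_top_of_not_forall {φ : ℝ → ℝ} {S : Set ℝ} (hS : IsPreconnected S)
    (hφ : AnalyticOnNhd ℝ φ S) (h : ¬ ∀ x ∈ S, φ x = 0) {x : ℝ} (hx : x ∈ S) :
    analyticOrderAt φ x ≠ ⊤ := fun htop =>
  h fun _ hy => hφ.eqOn_zero_of_preconnected_of_eventuallyEq_zero hS hx
    (analyticOrderAt_eq_top.1 htop) hy

/-! ### The parameter polynomial -/

theorem sq_lt_eval_of_ne {μ : ℝ[X]} (h0 : ∀ k ∈ Ioo (-1 : ℝ) 1, μ.eval k ∈ Ioo (0 : ℝ) 1)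
    (hne : ∀ k ∈ Ioo (-1 : ℝ) 1, μ.eval k ≠ k ^ 2) {k : ℝ} (hk : k ∈ Ioo (-1 : ℝ) 1) :
    k ^ 2 < μ.eval k := by
  by_contra! hlt
  have h00 : (0 : ℝ) ∈ Ioo (-1 : ℝ) 1 := by norm_num
  obtain ⟨x, hx, hx0⟩ := isPreconnected_Ioo.intermediate_value₂ hk h00
    (f := fun k => μ.eval k) (g := fun k => k ^ 2) μ.continuous.continuousOn (by fun_prop) hlt
    (by simpa using (h0 0 h00).1.le)
  exact hne x hx hx0

theorem exists_one_sub_eq_mul {μ : ℝ[X]} (h0 : ∀ k ∈ Ioo (-1 : ℝ) 1, μ.eval k ∈ Ioo (0 : ℝ) 1)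
    (hne : ∀ k ∈ Ioo (-1 : ℝ) 1, μ.eval k ≠ k ^ 2) :
    ∃ ν : ℝ[X], μ = 1 - (1 - X ^ 2) * ν ∧ ν.natDegree + 2 ≤ μ.natDegree ∧
      ∀ k ∈ Ioo (-1 : ℝ) 1, ν.eval k ∈ Ioo (0 : ℝ) 1 := by
  have hend : ∀ k : ℝ, k ∈ Icc (-1 : ℝ) 1 → k ^ 2 = 1 → μ.eval k = 1 := by
    intro k hk hk2
    rw [← closure_Ioo (by norm_num)] at hk
    refine le_antisymm ?_ ?_
    · exact le_on_closure (f := fun k => μ.eval k) (g := fun _ => 1) (fun x hx => (h0 x hx).2.le)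
        μ.continuous.continuousOn continuousOn_const hk
    · rw [← hk2]
      exact le_on_closure (f := fun k => k ^ 2) (g := fun k => μ.eval k)
        (fun x hx => (sq_lt_eval_of_ne h0 hne hx).le) (by fun_prop) μ.continuous.continuousOn hk
  obtain ⟨g, hg⟩ : X - C 1 ∣ 1 - μ := dvd_iff_isRoot.2 (by
    simp [hend 1 (by norm_num) (by norm_num)])
  obtain ⟨h, hh⟩ : X - C (-1) ∣ g := dvd_iff_isRoot.2 (by
    have := congrArg (eval (-1)) hg
    simp only [eval_sub, eval_one, hend (-1) (by norm_num) (by norm_num), eval_mul, eval_X,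
      eval_C] at this
    rw [IsRoot.def]
    linarith)
  have hμ : μ = 1 - (1 - X ^ 2) * -h := by
    rw [hh] at hg
    simp only [map_neg, map_one] at hg
    linear_combination -hg
  have hev (k : ℝ) : μ.eval k = 1 - (1 - k ^ 2) * (-h).eval k := by
    conv_lhs => rw [hμ]
    simp
  have hν : ∀ k ∈ Ioo (-1 : ℝ) 1, (-h).eval k ∈ Ioo (0 : ℝ) 1 := by
    intro k hk
    have h1 := hev k
    have h2 := one_sub_sq_pos hk
    have h3 := sq_lt_eval_of_ne h0 hne hk
    have h4 := (h0 k hk).2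
    exact ⟨by by_contra! h; nlinarith, by by_contra! h; nlinarith⟩
  refine ⟨-h, hμ, ?_, hν⟩
  have hne0 : -h ≠ 0 := by
    intro h
    have := (hν 0 (by norm_num)).1
    simp [h] at this
  have hX : (1 - X ^ 2 : ℝ[X]).natDegree = 2 := by compute_degree!
  have hX0 : (1 - X ^ 2 : ℝ[X]) ≠ 0 := by
    intro h
    rw [h] at hX
    simp at hX
  have hdeg : ((1 - X ^ 2 : ℝ[X]) * -h).natDegree = 2 + (-h).natDegree := by
    rw [natDegree_mul hX0 hne0, hX]
  have h5 : (1 - X ^ 2 : ℝ[X]) * -h = 1 - μ := by rw [hμ]; ring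
  rw [h5] at hdeg
  have h6 : (1 - μ).natDegree ≤ max (1 : ℝ[X]).natDegree μ.natDegree := natDegree_sub_le _ _
  rw [natDegree_one] at h6
  omega

/-- The leading coefficient of the first order differential equation satisfied by
`k ↦ Π(μ(k), k)`, where `μ = 1 - (1 - k²) ν`. -/
noncomputable def picLead (μ ν : ℝ[X]) : ℝ[X] := 2 * X * (1 - X ^ 2) * ν * (1 - ν) * μ

/-- The coefficient of order zero of the first order differential equation satisfied by
`k ↦ Π(μ(k), k)`, where `μ = 1 - (1 - k²) ν`. -/
noncomputable def picTail (μ ν : ℝ[X]) : ℝ[X] :=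
  X * (-4 * X * ν * (1 - ν) * μ + (1 - X ^ 2) * derivative ν * (1 - 2 * ν) * μ -
    (1 - X ^ 2) * ν * (1 - ν) * derivative μ)

/-- The coefficient of `K` in `D (r φ' - r' φ) + A r φ`, where `φ = p K + q E + r Π`. -/
noncomputable def wronskianK (μ ν p q r : ℝ[X]) : ℝ[X] :=
  picLead μ ν * (r * derivative p - derivative r * p) -
    2 * ν * (1 - ν) * μ * (1 - X ^ 2) * r * (p + q) + picTail μ ν * r * p -
    r ^ 2 * X * derivative μ * (1 - ν)

/-- The coefficient of `E` in `D (r φ' - r' φ) + A r φ`, where `φ = p K + q E + r Π`. -/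
noncomputable def wronskianE (μ ν p q r : ℝ[X]) : ℝ[X] :=
  picLead μ ν * (r * derivative q - derivative r * q) +
    2 * ν * (1 - ν) * μ * r * (p + (1 - X ^ 2) * q) + picTail μ ν * r * q -
    r ^ 2 * X * μ * derivative ν

theorem eval_param {μ ν : ℝ[X]} (hμ : μ = 1 - (1 - X ^ 2) * ν) (k : ℝ) :
    μ.eval k = 1 - (1 - k ^ 2) * ν.eval k := by
  rw [hμ]; simp

theorem eval_derivative_param {μ ν : ℝ[X]} (hμ : μ = 1 - (1 - X ^ 2) * ν) (k : ℝ) :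
    (derivative μ).eval k = 2 * k * ν.eval k - (1 - k ^ 2) * (derivative ν).eval k := by
  rw [hμ]; simp; ring

theorem exists_hasDerivAt_Pic_of_param {μ ν : ℝ[X]} (hμ : μ = 1 - (1 - X ^ 2) * ν)
    (hμ1 : ∀ k ∈ Ioo (-1 : ℝ) 1, μ.eval k < 1) {k : ℝ} (hk : k ∈ Ioo (-1 : ℝ) 1) :
    ∃ e, HasDerivAt (fun k => Pic (μ.eval k) k) e k ∧
      (picLead μ ν).eval k * e = -(picTail μ ν).eval k * Pic (μ.eval k) k -
        k * μ.eval k * (derivative ν).eval k * Ec k -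
        k * (derivative μ).eval k * (1 - ν.eval k) * Kc k := by
  obtain ⟨e, he, heq⟩ := exists_hasDerivAt_Pic hk hμ1
  refine ⟨e, he, ?_⟩
  have h1 : (1 - k ^ 2) ^ 2 ≠ 0 := (pow_pos (one_sub_sq_pos hk) 2).ne'
  simp only [picLead, picTail, eval_mul, eval_add, eval_sub, eval_neg, eval_pow, eval_X, eval_one,
    eval_ofNat]
  generalize Pic (μ.eval k) k = y at *
  rw [eval_derivative_param hμ, eval_param hμ] at *
  generalize ν.eval k = v at *
  generalize (derivative ν).eval k = v' at *
  refine mul_left_cancel₀ h1 ?_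
  linear_combination k * heq

theorem exists_hasDerivAt_wronskian {μ ν : ℝ[X]} (hμ : μ = 1 - (1 - X ^ 2) * ν)
    (hμ1 : ∀ k ∈ Ioo (-1 : ℝ) 1, μ.eval k < 1) (p q r : ℝ[X]) {k : ℝ} (hk : k ∈ Ioo (-1 : ℝ) 1) :
    ∃ e, HasDerivAt (fun k => p.eval k * Kc k + q.eval k * Ec k + r.eval k * Pic (μ.eval k) k) e k ∧
      (picLead μ ν).eval k * (r.eval k * e - (derivative r).eval k *
        (p.eval k * Kc k + q.eval k * Ec k + r.eval k * Pic (μ.eval k) k)) +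
        (picTail μ ν).eval k * r.eval k *
          (p.eval k * Kc k + q.eval k * Ec k + r.eval k * Pic (μ.eval k) k) =
      (wronskianK μ ν p q r).eval k * Kc k + (wronskianE μ ν p q r).eval k * Ec k := by
  obtain ⟨eK, hK, hKeq⟩ := exists_hasDerivAt_Kc hk
  obtain ⟨eE, hE, hEeq⟩ := exists_hasDerivAt_Ec hk
  obtain ⟨eP, hP, hPeq⟩ := exists_hasDerivAt_Pic_of_param hμ hμ1 hk
  refine ⟨_, (((p.hasDerivAt k).mul hK).add ((q.hasDerivAt k).mul hE)).add
    ((r.hasDerivAt k).mul hP), ?_⟩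
  have hD : (picLead μ ν).eval k = 2 * k * (1 - k ^ 2) * ν.eval k * (1 - ν.eval k) * μ.eval k := by
    simp [picLead]
  simp only [wronskianK, wronskianE, eval_mul, eval_add, eval_sub, eval_pow, eval_X, eval_one,
    eval_ofNat]
  rw [hD] at hPeq ⊢
  generalize Pic (μ.eval k) k = y at *
  generalize (picTail μ ν).eval k = a at *
  linear_combination r.eval k ^ 2 * hPeq +
    r.eval k * p.eval k * (2 * ν.eval k * (1 - ν.eval k) * μ.eval k) * hKeq +
    r.eval k * q.eval k * (2 * (1 - k ^ 2) * ν.eval k * (1 - ν.eval k) * μ.eval k) * hEeq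

theorem natDegree_one_sub_le {ν : ℝ[X]} {a : ℕ} (h : ν.natDegree ≤ a) : (1 - ν).natDegree ≤ a :=
  (natDegree_sub_le _ _).trans (by simpa using h)

theorem natDegree_picLead_le {μ ν : ℝ[X]} {a s : ℕ} (hμ : μ.natDegree ≤ s) (hν : ν.natDegree ≤ a) :
    (picLead μ ν).natDegree ≤ 3 + 2 * a + s := by
  have hX : (2 * X * (1 - X ^ 2) : ℝ[X]).natDegree ≤ 3 := by compute_degree
  exact (natDegree_mul_le_of_le (natDegree_mul_le_of_le (natDegree_mul_le_of_le hX hν)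
    (natDegree_one_sub_le hν)) hμ).trans (by omega)

theorem natDegree_picTail_le {μ ν : ℝ[X]} {a s : ℕ} (hμ : μ.natDegree ≤ s) (hν : ν.natDegree ≤ a) :
    (picTail μ ν).natDegree ≤ 3 + 2 * a + s := by
  have h4X : (-4 * X : ℝ[X]).natDegree ≤ 1 := by compute_degree
  have hX2 : (1 - X ^ 2 : ℝ[X]).natDegree ≤ 2 := by compute_degree
  have h2ν : (1 - 2 * ν).natDegree ≤ a := natDegree_one_sub_le (natDegree_C_mul_le 2 ν |>.trans hν)
  have hν' : (derivative ν).natDegree ≤ a := (natDegree_derivative_le ν).trans (by omega)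
  have hμ' : (derivative μ).natDegree ≤ s := (natDegree_derivative_le μ).trans (by omega)
  exact (natDegree_mul_le_of_le natDegree_X_le (natDegree_sub_le_of_le (natDegree_add_le_of_le
    (natDegree_mul_le_of_le (natDegree_mul_le_of_le (natDegree_mul_le_of_le h4X hν)
      (natDegree_one_sub_le hν)) hμ)
    (natDegree_mul_le_of_le (natDegree_mul_le_of_le (natDegree_mul_le_of_le hX2 hν') h2ν) hμ))
    (natDegree_mul_le_of_le (natDegree_mul_le_of_le (natDegree_mul_le_of_le hX2 hν)
      (natDegree_one_sub_le hν)) hμ'))).trans (by omega)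

theorem natDegree_wronskian_le {μ ν p q r : ℝ[X]} {a s M l d : ℕ} (hμ : μ.natDegree ≤ s)
    (hν : ν.natDegree ≤ a) (hp : p.natDegree ≤ M) (hq : q.natDegree ≤ M) (hr : r.natDegree ≤ l)
    (h1 : 3 + 2 * a + s + l + M ≤ d) (h2 : 2 * l + 1 + s + a ≤ d) :
    (wronskianK μ ν p q r).natDegree ≤ d ∧ (wronskianE μ ν p q r).natDegree ≤ d := by
  have hX2 : (1 - X ^ 2 : ℝ[X]).natDegree ≤ 2 := by compute_degree
  have hν' : (derivative ν).natDegree ≤ a := (natDegree_derivative_le ν).trans (by omega)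
  have hμ' : (derivative μ).natDegree ≤ s := (natDegree_derivative_le μ).trans (by omega)
  have hp' : (derivative p).natDegree ≤ M := (natDegree_derivative_le p).trans (by omega)
  have hq' : (derivative q).natDegree ≤ M := (natDegree_derivative_le q).trans (by omega)
  have hr' : (derivative r).natDegree ≤ l := (natDegree_derivative_le r).trans (by omega)
  have h2ν : (2 * ν).natDegree ≤ a := (natDegree_C_mul_le 2 ν).trans hν
  have hr2 : (r ^ 2 * X).natDegree ≤ 2 * l + 1 :=
    natDegree_mul_le_of_le (natDegree_pow_le_of_le 2 hr) natDegree_X_le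
  have hB := natDegree_mul_le_of_le (natDegree_mul_le_of_le h2ν (natDegree_one_sub_le hν)) hμ
  have hD := natDegree_picLead_le hμ hν
  have hA := natDegree_picTail_le hμ hν
  constructor
  · exact (natDegree_sub_le_of_le (natDegree_add_le_of_le (natDegree_sub_le_of_le
      (natDegree_mul_le_of_le hD (natDegree_sub_le_of_le (natDegree_mul_le_of_le hr hp')
        (natDegree_mul_le_of_le hr' hp)))
      (natDegree_mul_le_of_le (natDegree_mul_le_of_le (natDegree_mul_le_of_le hB hX2) hr)
        (natDegree_add_le_of_le hp hq)))
      (natDegree_mul_le_of_le (natDegree_mul_le_of_le hA hr) hp))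
      (natDegree_mul_le_of_le (natDegree_mul_le_of_le hr2 hμ') (natDegree_one_sub_le hν))).trans
      (by omega)
  · exact (natDegree_sub_le_of_le (natDegree_add_le_of_le (natDegree_add_le_of_le
      (natDegree_mul_le_of_le hD (natDegree_sub_le_of_le (natDegree_mul_le_of_le hr hq')
        (natDegree_mul_le_of_le hr' hq)))
      (natDegree_mul_le_of_le (natDegree_mul_le_of_le hB hr)
        (natDegree_add_le_of_le hp (natDegree_mul_le_of_le hX2 hq))))
      (natDegree_mul_le_of_le (natDegree_mul_le_of_le hA hr) hq))
      (natDegree_mul_le_of_le (natDegree_mul_le_of_le hr2 hμ) hν')).trans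
      (by omega)

/-- A positive solution of `D w' = A w`. -/
noncomputable def picWeight (μ ν : ℝ[X]) (k : ℝ) : ℝ :=
  (1 - k ^ 2) * √(ν.eval k * (1 - ν.eval k) / μ.eval k)

theorem picWeight_pos {μ ν : ℝ[X]} {k : ℝ} (hk : k ∈ Ioo (-1 : ℝ) 1)
    (hμ0 : 0 < μ.eval k) (hν : ν.eval k ∈ Ioo (0 : ℝ) 1) : 0 < picWeight μ ν k :=
  mul_pos (one_sub_sq_pos hk)
    (Real.sqrt_pos.2 (div_pos (mul_pos hν.1 (sub_pos.2 hν.2)) hμ0))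

theorem exists_hasDerivAt_picWeight {μ ν : ℝ[X]} {k : ℝ}
    (hμ0 : 0 < μ.eval k) (hν : ν.eval k ∈ Ioo (0 : ℝ) 1) :
    ∃ e, HasDerivAt (picWeight μ ν) e k ∧
      (picLead μ ν).eval k * e = (picTail μ ν).eval k * picWeight μ ν k := by
  have hν1 : 0 < 1 - ν.eval k := sub_pos.2 hν.2
  have hpos : 0 < ν.eval k * (1 - ν.eval k) / μ.eval k := div_pos (mul_pos hν.1 hν1) hμ0
  have hd := ((ν.hasDerivAt k).mul ((ν.hasDerivAt k).const_sub 1)).div (μ.hasDerivAt k) hμ0.ne'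
  refine ⟨_, ((((hasDerivAt_id k).pow 2).const_sub 1).mul (hd.sqrt hpos.ne')), ?_⟩
  have hs : 0 < √(ν.eval k * (1 - ν.eval k) / μ.eval k) := Real.sqrt_pos.2 hpos
  have hsq := Real.sq_sqrt hpos.le
  simp only [picLead, picTail, picWeight, eval_mul, eval_add, eval_sub, eval_neg, eval_pow, eval_X,
    eval_one, eval_ofNat, Pi.mul_apply, Pi.div_apply, id, Pi.pow_apply]
  generalize √(ν.eval k * (1 - ν.eval k) / μ.eval k) = w at *
  rw [eq_div_iff hμ0.ne'] at hsq
  field_simp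
  push_cast
  linear_combination -k * (1 - k ^ 2) ^ 2 * (μ.eval k * (derivative ν).eval k * (1 - 2 * ν.eval k) -
    ν.eval k * (1 - ν.eval k) * (derivative μ).eval k) * hsq

/-- The function `p K + q E + r Π(μ, ·)`. -/
noncomputable def ellipticSum (μ p q r : ℝ[X]) (k : ℝ) : ℝ :=
  p.eval k * Kc k + q.eval k * Ec k + r.eval k * Pic (μ.eval k) k

theorem analyticAt_eval (P : ℝ[X]) (x : ℝ) : AnalyticAt ℝ (fun k => P.eval k) x :=
  AnalyticOnNhd.eval_polynomial P x (mem_univ x)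

theorem analyticAt_ellipticSum {μ : ℝ[X]} (hμ : ∀ k ∈ Ioo (-1 : ℝ) 1, μ.eval k ∈ Ioo (0 : ℝ) 1)
    (p q r : ℝ[X]) {k : ℝ} (hk : k ∈ Ioo (-1 : ℝ) 1) : AnalyticAt ℝ (ellipticSum μ p q r) k :=
  (((analyticAt_eval p k).mul (analyticAt_Kc hk)).add
    ((analyticAt_eval q k).mul (analyticAt_Ec hk))).add
    ((analyticAt_eval r k).mul (analyticAt_Pic
      (fun k hk => abs_lt.2 ⟨by linarith [(hμ k hk).1], (hμ k hk).2⟩) hk))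

theorem analyticAt_eval_mul_Kc_add_eval_mul_Ec (P Q : ℝ[X]) {k : ℝ} (hk : k ∈ Ioo (-1 : ℝ) 1) :
    AnalyticAt ℝ (fun k => P.eval k * Kc k + Q.eval k * Ec k) k :=
  ((analyticAt_eval P k).mul (analyticAt_Kc hk)).add ((analyticAt_eval Q k).mul (analyticAt_Ec hk))

theorem exists_hasDerivAt_picWeight_mul_div {μ ν : ℝ[X]} (hμν : μ = 1 - (1 - X ^ 2) * ν)
    (hμ : ∀ k ∈ Ioo (-1 : ℝ) 1, μ.eval k ∈ Ioo (0 : ℝ) 1)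
    (hν : ∀ k ∈ Ioo (-1 : ℝ) 1, ν.eval k ∈ Ioo (0 : ℝ) 1) (p q : ℝ[X]) {r : ℝ[X]} {k : ℝ}
    (hk : k ∈ Ioo (-1 : ℝ) 1) (hr : r.eval k ≠ 0) :
    ∃ e, HasDerivAt (fun k => picWeight μ ν k * ellipticSum μ p q r k / r.eval k) e k ∧
      (picLead μ ν).eval k * e * r.eval k ^ 2 = picWeight μ ν k *
        ((wronskianK μ ν p q r).eval k * Kc k + (wronskianE μ ν p q r).eval k * Ec k) := by
  obtain ⟨e, he, heq⟩ := exists_hasDerivAt_wronskian hμν (fun k hk => (hμ k hk).2) p q r hk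
  obtain ⟨w, hw, hweq⟩ := exists_hasDerivAt_picWeight (hμ k hk).1 (hν k hk)
  refine ⟨_, (hw.mul he).div (r.hasDerivAt k) hr, ?_⟩
  rw [← heq]
  simp only [Pi.mul_apply]
  generalize p.eval k * Kc k + q.eval k * Ec k + r.eval k * Pic (μ.eval k) k = y at *
  field_simp
  linear_combination r.eval k * y * hweq

theorem exists_wronskian_eq_zero {μ ν : ℝ[X]} (hμν : μ = 1 - (1 - X ^ 2) * ν)
    (hμ : ∀ k ∈ Ioo (-1 : ℝ) 1, μ.eval k ∈ Ioo (0 : ℝ) 1)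
    (hν : ∀ k ∈ Ioo (-1 : ℝ) 1, ν.eval k ∈ Ioo (0 : ℝ) 1) {p q r : ℝ[X]} {x y : ℝ}
    (hx : x ∈ Ioo (-1 : ℝ) 1) (hy : y ∈ Ioo (-1 : ℝ) 1) (hxy : x < y)
    (hx0 : ellipticSum μ p q r x = 0) (hy0 : ellipticSum μ p q r y = 0)
    (hr : ∀ z ∈ Icc x y, r.eval z ≠ 0) :
    ∃ z ∈ Ioo x y,
      (wronskianK μ ν p q r).eval z * Kc z + (wronskianE μ ν p q r).eval z * Ec z = 0 := by
  have hd := fun z (hz : z ∈ Icc x y) => exists_hasDerivAt_picWeight_mul_div hμν hμ hν p q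
    (ordConnected_Ioo.out hx hy hz) (hr z hz)
  choose! e he heq using hd
  obtain ⟨z, hz, hz0⟩ := exists_hasDerivAt_eq_zero hxy
    (fun z hz => (he z hz).continuousAt.continuousWithinAt) (by simp [hx0, hy0])
    fun z hz => he z (Ioo_subset_Icc_self hz)
  have hz' := Ioo_subset_Icc_self hz
  have hzmem : z ∈ Ioo (-1 : ℝ) 1 := ordConnected_Ioo.out hx hy hz'
  have h1 := heq z hz'
  rw [hz0, mul_zero, zero_mul, eq_comm, mul_eq_zero] at h1
  exact ⟨z, hz, h1.resolve_left (picWeight_pos hzmem (hμ z hzmem).1 (hν z hzmem)).ne'⟩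

theorem sum_analyticOrderNatAt_ellipticSum_le_of_wronskian_eq_zero {μ ν : ℝ[X]}
    (hμν : μ = 1 - (1 - X ^ 2) * ν)
    (hμ : ∀ k ∈ Ioo (-1 : ℝ) 1, μ.eval k ∈ Ioo (0 : ℝ) 1)
    (hν : ∀ k ∈ Ioo (-1 : ℝ) 1, ν.eval k ∈ Ioo (0 : ℝ) 1) {p q r : ℝ[X]} (hr : r ≠ 0)
    (hV : ∀ k ∈ Ioo (-1 : ℝ) 1,
      (wronskianK μ ν p q r).eval k * Kc k + (wronskianE μ ν p q r).eval k * Ec k = 0)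
    (hne : ¬ ∀ k ∈ Ioo (-1 : ℝ) 1, ellipticSum μ p q r k = 0)
    {T : Finset ℝ} (hT : ∀ x ∈ T, x ∈ Ioo (-1 : ℝ) 1) :
    ∑ x ∈ T, analyticOrderNatAt (ellipticSum μ p q r) x ≤ r.natDegree := by
  obtain ⟨x₀, hx₀, hrx₀⟩ : ∃ x ∈ Ioo (0 : ℝ) 1, r.eval x ≠ 0 := by
    obtain ⟨t, ht, htr⟩ := (Ioo_infinite (zero_lt_one' ℝ)).exists_notMem_finset r.roots.toFinset
    exact ⟨t, ht, fun h => htr (by simpa [hr] using h)⟩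
  obtain ⟨δ, hδ, hball⟩ := Metric.isOpen_iff.1
    (isOpen_Ioo.inter (isOpen_ne_fun r.continuous continuous_const)) x₀ ⟨hx₀, hrx₀⟩
  have hsub : Ioo (0 : ℝ) 1 ⊆ Ioo (-1) 1 := Ioo_subset_Ioo_left (by norm_num)
  have hderiv : ∀ k ∈ Metric.ball x₀ δ,
      HasDerivAt (fun k => picWeight μ ν k * ellipticSum μ p q r k / r.eval k) 0 k := by
    intro k hkb
    obtain ⟨hk0, hrk⟩ := hball hkb
    have hk := hsub hk0
    have hrk : r.eval k ≠ 0 := hrk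
    obtain ⟨e, he, heq⟩ := exists_hasDerivAt_picWeight_mul_div hμν hμ hν p q hk hrk
    rw [hV k hk, mul_zero, mul_eq_zero, mul_eq_zero] at heq
    have hD : (picLead μ ν).eval k ≠ 0 := by
      have h1 := one_sub_sq_pos hk
      have h2 := sub_pos.2 (hν k hk).2
      have h3 := (hν k hk).1
      have h4 := (hμ k hk).1
      have h5 := hk0.1
      simp only [picLead, eval_mul, eval_sub, eval_pow, eval_X, eval_one, eval_ofNat]
      positivity
    have he0 : e = 0 := (heq.resolve_right (pow_ne_zero 2 hrk)).resolve_left hD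
    rwa [he0] at he
  obtain ⟨c, hc⟩ := Metric.isOpen_ball.exists_is_const_of_deriv_eq_zero
    (convex_ball x₀ δ).isPreconnected
    (fun k hk => (hderiv k hk).differentiableAt.differentiableWithinAt) fun k hk => (hderiv k hk).deriv
  have hφan := fun k hk => analyticAt_ellipticSum hμ p q r (k := k) hk
  set L : ℝ[X] := (1 - X ^ 2) ^ 2 * ν * (1 - ν) with hL
  have hLeval (k : ℝ) : L.eval k = (1 - k ^ 2) ^ 2 * (ν.eval k * (1 - ν.eval k)) := by
    simp [hL, mul_assoc]
  have hLpos : ∀ k ∈ Ioo (-1 : ℝ) 1, 0 < L.eval k := fun k hk => by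
    rw [hLeval]
    exact mul_pos (pow_pos (one_sub_sq_pos hk) 2) (mul_pos (hν k hk).1 (sub_pos.2 (hν k hk).2))
  have heq : EqOn ((fun k => L.eval k) * ellipticSum μ p q r ^ 2)
      ((fun k => (C (c ^ 2) * μ).eval k) * (fun k => r.eval k) ^ 2) (Ioo (-1) 1) := by
    refine AnalyticOnNhd.eqOn_of_preconnected_of_eventuallyEq
      (fun k hk => (analyticAt_eval L k).mul ((hφan k hk).pow 2))
      (fun k _ => (analyticAt_eval _ k).mul ((analyticAt_eval r k).pow 2))
      isPreconnected_Ioo (hsub hx₀) ?_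
    filter_upwards [Metric.ball_mem_nhds x₀ hδ] with k hkb
    have hk := hsub (hball hkb).1
    have hrk : r.eval k ≠ 0 := (hball hkb).2
    have h1 : picWeight μ ν k * ellipticSum μ p q r k / r.eval k = c := hc k hkb
    have h2 : 0 < ν.eval k * (1 - ν.eval k) / μ.eval k :=
      div_pos (mul_pos (hν k hk).1 (sub_pos.2 (hν k hk).2)) (hμ k hk).1
    have h3 : L.eval k = picWeight μ ν k ^ 2 * μ.eval k := by
      rw [hLeval, picWeight, mul_pow, Real.sq_sqrt h2.le, mul_assoc,
        div_mul_cancel₀ _ (hμ k hk).1.ne']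
    rw [div_eq_iff hrk] at h1
    simp only [Pi.mul_apply, Pi.pow_apply, eval_mul, eval_C]
    rw [h3]
    linear_combination μ.eval k * (picWeight μ ν k * ellipticSum μ p q r k + c * r.eval k) * h1
  have hc0 : c ≠ 0 := by
    rintro rfl
    refine hne fun k hk => ?_
    have := heq hk
    simpa [(hLpos k hk).ne'] using this
  refine (Finset.sum_congr rfl fun x hx => ?_).trans_le (sum_analyticOrderNatAt_eval_le r T)
  have hx := hT x hx
  have hord := analyticOrderAt_congr (heq.eventuallyEq_of_mem (isOpen_Ioo.mem_nhds hx))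
  rw [analyticOrderAt_mul (analyticAt_eval L x) ((hφan x hx).pow 2),
    analyticOrderAt_mul (analyticAt_eval _ x) ((analyticAt_eval r x).pow 2),
    (analyticAt_eval L x).analyticOrderAt_eq_zero.2 (hLpos x hx).ne',
    (analyticAt_eval _ x).analyticOrderAt_eq_zero.2 (by simp [hc0, (hμ x hx).1.ne']),
    zero_add, zero_add] at hord
  have h2 := congrArg ENat.toNat hord
  change analyticOrderNatAt _ _ = analyticOrderNatAt _ _ at h2
  rw [analyticOrderNatAt_pow (hφan x hx), analyticOrderNatAt_pow (analyticAt_eval r x)] at h2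
  simpa using h2

theorem sum_analyticOrderNatAt_ellipticSum_le {μ ν : ℝ[X]} (hμν : μ = 1 - (1 - X ^ 2) * ν)
    (hμ : ∀ k ∈ Ioo (-1 : ℝ) 1, μ.eval k ∈ Ioo (0 : ℝ) 1)
    (hν : ∀ k ∈ Ioo (-1 : ℝ) 1, ν.eval k ∈ Ioo (0 : ℝ) 1) {p q r : ℝ[X]} (hr : r ≠ 0)
    (hne : ¬ ∀ k ∈ Ioo (-1 : ℝ) 1, ellipticSum μ p q r k = 0) {d : ℕ}
    (hdK : (wronskianK μ ν p q r).natDegree ≤ d) (hdE : (wronskianE μ ν p q r).natDegree ≤ d)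
    {T : Finset ℝ} (hT : ∀ x ∈ T, x ∈ Ioo (-1 : ℝ) 1 ∧ ellipticSum μ p q r x = 0) :
    ∑ x ∈ T, analyticOrderNatAt (ellipticSum μ p q r) x ≤ 2 * d + 6 + r.natDegree + 1 := by
  set V : ℝ → ℝ := fun k =>
    (wronskianK μ ν p q r).eval k * Kc k + (wronskianE μ ν p q r).eval k * Ec k with hVdef
  by_cases hV : ∀ k ∈ Ioo (-1 : ℝ) 1, V k = 0
  · exact (sum_analyticOrderNatAt_ellipticSum_le_of_wronskian_eq_zero hμν hμ hν hr hV hne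
      fun x hx => (hT x hx).1).trans (by omega)
  have hVan : AnalyticOnNhd ℝ V (Ioo (-1) 1) := fun k hk =>
    analyticAt_eval_mul_Kc_add_eval_mul_Ec _ _ hk
  have hVtop := fun x hx =>
    analyticOrderAt_ne_top_of_not_forall isPreconnected_Ioo hVan hV (x := x) hx
  have hφan := fun k hk => analyticAt_ellipticSum hμ p q r (k := k) hk
  have hVeq : ∀ k ∈ Ioo (-1 : ℝ) 1, V k = ((fun k => (picLead μ ν * r).eval k) *
      deriv (ellipticSum μ p q r) + (fun k => (picTail μ ν * r - picLead μ ν * derivative r).eval k) *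
      ellipticSum μ p q r) k := by
    intro k hk
    obtain ⟨e, he, heq⟩ := exists_hasDerivAt_wronskian hμν (fun k hk => (hμ k hk).2) p q r hk
    have hde : deriv (ellipticSum μ p q r) k = e := he.deriv
    simp only [hVdef, Pi.add_apply, Pi.mul_apply, eval_mul, eval_sub, hde]
    rw [← heq, ellipticSum]
    ring
  have hord := fun x (hx : x ∈ Ioo (-1 : ℝ) 1) => analyticOrderAt_le_of_eq_mul_deriv_add
    (hφan x hx) (analyticAt_eval _ x) (analyticAt_eval _ x)
    (Filter.eventuallyEq_of_mem (isOpen_Ioo.mem_nhds hx) hVeq)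
  refine sum_le_of_rolle hr ordConnected_Ioo (φ := ellipticSum μ p q r) (V := V)
    (b := analyticOrderNatAt V)
    (fun x hx y hy hxy hx0 hy0 hr => exists_wronskian_eq_zero hμν hμ hν hx hy hxy hx0 hy0 hr)
    (fun x hx => ?_) (fun x hx hr0 => ?_) (fun x hx hVx => ?_)
    (fun T hT => sum_analyticOrderNatAt_eval_mul_Kc_add_eval_mul_Ec_le hdK hdE hT) hT
  · have h := (hord x hx).1
    rw [← Nat.cast_analyticOrderNatAt (hVtop x hx)] at h
    exact ENat.toNat_le_of_le_natCast (by exact_mod_cast h)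
  · have h := (hord x hx).2 (by simp [hr0])
    rw [← Nat.cast_analyticOrderNatAt (hVtop x hx)] at h
    exact ENat.toNat_le_of_le_natCast h
  · rw [Nat.one_le_iff_ne_zero]
    intro h
    refine (hVan x hx).analyticOrderAt_eq_zero.1 ?_ hVx
    rw [← Nat.cast_analyticOrderNatAt (hVtop x hx), h]
    rfl

end

/-- Theorem 1.3 of the paper: bound, counted with multiplicity, for the
number of zeros in `(-1,1)` of `I(k) = p(k)K(k) + q(k)E(k) + r(k)Π(μ(k),k)` with
polynomial coefficients and a polynomial parameter `μ`. -/
theorem zeros_of_pK_qE_rPi_polynomial_mu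
    (m n l s : ℕ) (p q r μ : Polynomial ℝ)
    (hp : p.natDegree ≤ m) (hq : q.natDegree ≤ n) (hr : r.natDegree ≤ l)
    (hs : μ.natDegree = s)
    (hμrange : ∀ k ∈ Set.Ioo (-1 : ℝ) 1, μ.eval k ∈ Set.Ioo (0 : ℝ) 1)
    (hμne : ∀ k ∈ Set.Ioo (-1 : ℝ) 1, μ.eval k ≠ k ^ 2)
    (hI : ¬ ∀ k ∈ Set.Ioo (-1 : ℝ) 1,
      p.eval k * Kc k + q.eval k * Ec k + r.eval k * Pic (μ.eval k) k = 0) :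
    ∀ T : Finset ℝ,
      (∀ x ∈ T, x ∈ Set.Ioo (-1 : ℝ) 1 ∧
        p.eval x * Kc x + q.eval x * Ec x + r.eval x * Pic (μ.eval x) x = 0) →
      ∑ x ∈ T,
        zeroMult (fun k => p.eval k * Kc k + q.eval k * Ec k + r.eval k * Pic (μ.eval k) k) x
        ≤ psiBound m n l s := by
  intro T hT
  obtain ⟨ν, hμν, hνdeg, hν⟩ := exists_one_sub_eq_mul hμrange hμne
  have hφan : AnalyticOnNhd ℝ (ellipticSum μ p q r) (Set.Ioo (-1) 1) := fun k hk =>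
    analyticAt_ellipticSum hμrange p q r hk
  have hsum : ∑ x ∈ T, zeroMult (ellipticSum μ p q r) x =
      ∑ x ∈ T, analyticOrderNatAt (ellipticSum μ p q r) x := Finset.sum_congr rfl fun x hx =>
    zeroMult_eq_analyticOrderNatAt (hφan x (hT x hx).1)
      (analyticOrderAt_ne_top_of_not_forall isPreconnected_Ioo hφan hI (hT x hx).1)
  change ∑ x ∈ T, zeroMult (ellipticSum μ p q r) x ≤ _
  have hpM : p.natDegree ≤ max m n := hp.trans (le_max_left m n)
  have hqM : q.natDegree ≤ max m n := hq.trans (le_max_right m n)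
  rw [hsum, psiBound, if_pos (by omega)]
  generalize max m n = M at *
  rcases eq_or_ne r 0 with rfl | hr0
  · have h0 : ellipticSum μ p q 0 = fun k => p.eval k * Kc k + q.eval k * Ec k := by
      funext k; simp [ellipticSum]
    rw [h0]
    refine (sum_analyticOrderNatAt_eval_mul_Kc_add_eval_mul_Ec_le hpM hqM
      fun x hx => (hT x hx).1).trans ?_
    split_ifs <;> omega
  · obtain ⟨hdK, hdE⟩ := natDegree_wronskian_le (d := max (M + l + 3 * s) (2 * l + 2 * s)) hs.le
      (Nat.le_sub_of_add_le hνdeg) hpM hqM hr (by omega) (by omega)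
    refine (sum_analyticOrderNatAt_ellipticSum_le hμν hμrange hν hr0 hI hdK hdE hT).trans ?_
    split_ifs <;> omega
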